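/- Suppose b satisfies Assumption 1 with ρ ∈ (1,2) and adopt the spectral setup. Let T > 0, 0 < s ≤ 1/ρ and γ < ρs/2. Then there exists C = C(T,γ) > 0 such that for every n ≥ 1, with Δt := T/n and t_k := kΔt, and every x ∈ H: (Σ_{k=1}^n ∫_{t_{k−1}}^{t_k} ‖(S(t_n − u) − S(t_n − t_{k−1})) x‖² du)^{1/2} ≤ C Δt^γ ‖x‖_{s − 1/ρ}. -/

import Mathlib

open MeasureTheory Filter Set
open scoped ENNReal NNReal RealInnerProductSpace

noncomputable section

/-- The Laplace transform `b̂(z) = ∫₀^∞ e^{-zt} b(t) dt` of a real-valued kernel `b`. -/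
def laplaceTransform (b : ℝ → ℝ) (z : ℂ) : ℂ :=
  ∫ t in Set.Ioi (0 : ℝ), Complex.exp (-z * t) * (b t : ℂ)

/-- Assumption 1: `b` is a nonzero, locally integrable, 3-monotone kernel
(with derivative `b'` on `(0,∞)`), `b(t) → 0` as `t → ∞`, and the angle condition
`ρ = 1 + (2/π) sup{|arg b̂(λ)| : Re λ > 0} ∈ (1,2)` holds. -/
structure Assumption1 (b b' : ℝ → ℝ) (ρ : ℝ) : Prop where
  locInt : ∀ T > 0, IntegrableOn b (Set.Ioc 0 T)
  ne_zero : ∃ t > 0, b t ≠ 0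
  nonneg : ∀ t > 0, 0 ≤ b t
  anti : AntitoneOn b (Set.Ioi 0)
  cvx : ConvexOn ℝ (Set.Ioi 0) b
  hasDeriv : ∀ t > 0, HasDerivAt b (b' t) t
  deriv_nonpos : ∀ t > 0, b' t ≤ 0
  deriv_anti : AntitoneOn (fun t => -(b' t)) (Set.Ioi 0)
  deriv_cvx : ConvexOn ℝ (Set.Ioi 0) (fun t => -(b' t))
  tendsto_zero : Tendsto b atTop (nhds 0)
  rho_eq : ρ = 1 + (2 / Real.pi) *
      sSup {θ : ℝ | ∃ z : ℂ, 0 < z.re ∧ θ = |(laplaceTransform b z).arg|}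
  rho_mem : ρ ∈ Set.Ioo (1 : ℝ) 2

/-- Assumption 2: `b̂` extends analytically to a sector `Σ_θ`, `θ > π/2`, with the
bounds `|b̂^{(k)}(z)| ≤ C |z|^{1-ρ-k}`, `k = 0,1`, there. -/
structure Assumption2 (b : ℝ → ℝ) (ρ θ : ℝ) : Prop where
  theta_gt : Real.pi / 2 < θ
  holo : ∃ B : ℂ → ℂ,
    (∀ z : ℂ, z ≠ 0 → |z.arg| < θ → DifferentiableAt ℂ B z) ∧
    (∀ z : ℂ, 0 < z.re → B z = laplaceTransform b z) ∧
    ∃ C > 0, (∀ z : ℂ, z ≠ 0 → |z.arg| < θ → ‖B z‖ ≤ C * ‖z‖ ^ (1 - ρ)) ∧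
      (∀ z : ℂ, z ≠ 0 → |z.arg| < θ → ‖deriv B z‖ ≤ C * ‖z‖ ^ (-ρ))

/-- `s` (with derivative `s'` on `(0,∞)`) solves the scalar Volterra equation
`s'(t) + λ ∫₀ᵗ b(t-u) s(u) du = 0`, `s(0) = 1`. -/
structure IsScalarSolution (b : ℝ → ℝ) (lam : ℝ) (s s' : ℝ → ℝ) : Prop where
  init : s 0 = 1
  cont : ContinuousOn s (Set.Ici 0)
  hasDeriv : ∀ t > 0, HasDerivAt s (s' t) t
  eqn : ∀ t > 0, s' t + lam * ∫ u in (0 : ℝ)..t, b (t - u) * s u = 0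

/-- The resolvent family `S(t)x = Σ_k s_k(t) (x,e_k) e_k`. -/
def Sop {H : Type*} [NormedAddCommGroup H] [InnerProductSpace ℝ H]
    (e : HilbertBasis ℕ ℝ H) (s : ℕ → ℝ → ℝ) (t : ℝ) (x : H) : H :=
  ∑' k, (s k t * ⟪x, e k⟫) • (e k : H)

/-- The Backward Euler convolution quadrature operator
`B_k = ∫₀^∞ F(Δt s) e^{-s} s^{k-1}/(k-1)! ds`. -/
def quadB {H : Type*} [NormedAddCommGroup H] [NormedSpace ℝ H]
    (Δt : ℝ) (F : ℝ → H) (k : ℕ) : H :=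
  ∫ u in Set.Ioi (0 : ℝ),
    (Real.exp (-u) * u ^ (k - 1) / (Nat.factorial (k - 1) : ℝ)) • F (Δt * u)

/-- The finite element setup: `f` is an orthonormal basis of the finite dimensional
subspace `V_h ⊆ D(A^{1/2})`, consisting of eigenvectors of the discrete operator `A_h`
(defined via the bilinear form `a(u,v) = Σ_k λ_k (u,e_k)(v,e_k)`) with positive
eigenvalues `μ`. -/
structure FESetup {H : Type*} [NormedAddCommGroup H] [InnerProductSpace ℝ H]
    (e : HilbertBasis ℕ ℝ H) (lam : ℕ → ℝ) (N : ℕ) (f : Fin N → H) (μ : Fin N → ℝ) :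
    Prop where
  f_orth : Orthonormal ℝ f
  mu_pos : ∀ j, 0 < μ j
  f_dom : ∀ j, (∑' k, ENNReal.ofReal (lam k * ⟪f j, e k⟫ ^ 2)) < ⊤
  eigen : ∀ j j', (∑' k, lam k * ⟪f j, e k⟫ * ⟪f j', e k⟫) = μ j * ⟪f j, f j'⟫

open scoped FourierTransform

theorem continuous_fourier_of_integrable {f : ℝ → ℂ} (hf : Integrable f) : Continuous (𝓕 f) :=
  VectorFourier.fourierIntegral_continuous Real.continuous_fourierChar
    (by exact continuous_inner) hf

theorem integral_fourier_mul_eq {f g : ℝ → ℂ} (hf : Integrable f) (hg : Integrable g) :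
    ∫ ξ, 𝓕 f ξ * g ξ = ∫ x, f x * 𝓕 g x := by
  have h := VectorFourier.integral_fourierIntegral_smul_eq_flip (L := innerₗ ℝ)
    (μ := (volume : Measure ℝ)) (ν := (volume : Measure ℝ))
    Real.continuous_fourierChar (by exact continuous_inner) hf hg
  have hflip : (innerₗ ℝ : ℝ →ₗ[ℝ] ℝ →ₗ[ℝ] ℝ).flip = innerₗ ℝ := flip_innerₗ ℝ
  rw [hflip] at h
  simp only [smul_eq_mul] at h
  exact h

/-- On `L¹ ∩ L²` the Fourier integral represents the `L²` Fourier transform. -/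
theorem coeFn_fourier_toLp {f : ℝ → ℂ} (hf : Integrable f) (hf2 : MemLp f 2) :
    (𝓕 (hf2.toLp f) : Lp ℂ 2 (volume : Measure ℝ)) =ᵐ[volume] 𝓕 f := by
  refine ae_eq_of_integral_contDiff_smul_eq
    ((Lp.memLp _).locallyIntegrable (by norm_num))
    (continuous_fourier_of_integrable hf).locallyIntegrable ?_
  intro g hg hgc
  have hgC : ContDiff ℝ (↑(⊤ : ℕ∞)) (fun x => (g x : ℂ)) :=
    Complex.ofRealCLM.contDiff.comp hg
  have hgcC : HasCompactSupport (fun x => (g x : ℂ)) :=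
    hgc.comp_left (g := fun x : ℝ => (x : ℂ)) Complex.ofReal_zero
  set φ : SchwartzMap ℝ ℂ := hgcC.toSchwartzMap hgC with hφ
  have hφx : ∀ x, φ x = (g x : ℂ) := fun x => rfl
  have h1 := congrArg (fun S => S φ) (Lp.fourier_toTemperedDistribution_eq (hf2.toLp f))
  simp only [TemperedDistribution.fourier_apply, Lp.toTemperedDistribution_apply] at h1
  have h2 : ∫ x, (𝓕 φ) x • (hf2.toLp f : ℝ → ℂ) x = ∫ x, 𝓕 (φ : ℝ → ℂ) x * f x := by
    refine integral_congr_ae ?_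
    filter_upwards [hf2.coeFn_toLp] with x hx
    rw [hx, SchwartzMap.fourier_coe, smul_eq_mul]
  have h3 := integral_fourier_mul_eq φ.integrable hf
  rw [h2, h3] at h1
  calc ∫ x, g x • (𝓕 (hf2.toLp f) : Lp ℂ 2 (volume : Measure ℝ)) x
      = ∫ x, φ x • (𝓕 (hf2.toLp f) : Lp ℂ 2 (volume : Measure ℝ)) x := by
        refine integral_congr_ae (.of_forall fun x => ?_)
        simp [hφx]
    _ = ∫ x, φ x * 𝓕 f x := h1.symm
    _ = ∫ x, g x • 𝓕 f x := by
        refine integral_congr_ae (.of_forall fun x => ?_)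
        simp [hφx]

theorem memLp_fourier {f : ℝ → ℂ} (hf : Integrable f) (hf2 : MemLp f 2) : MemLp (𝓕 f) 2 :=
  (memLp_congr_ae (coeFn_fourier_toLp hf hf2)).1 (Lp.memLp _)

theorem integral_conj_fourier_mul_fourier {f g : ℝ → ℂ} (hf : Integrable f) (hf2 : MemLp f 2)
    (hg : Integrable g) (hg2 : MemLp g 2) :
    ∫ ξ, (starRingEnd ℂ) (𝓕 f ξ) * 𝓕 g ξ = ∫ x, (starRingEnd ℂ) (f x) * g x := by
  have h := Lp.inner_fourier_eq (hf2.toLp f) (hg2.toLp g)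
  rw [L2.inner_def, L2.inner_def] at h
  calc _ = _ := ?_
    _ = _ := h
    _ = _ := ?_
  · refine integral_congr_ae ?_
    filter_upwards [coeFn_fourier_toLp hf hf2, coeFn_fourier_toLp hg hg2] with x h1 h2
    rw [h1, h2, RCLike.inner_apply, mul_comm]
  · refine integral_congr_ae ?_
    filter_upwards [hf2.coeFn_toLp, hg2.coeFn_toLp] with x h1 h2
    rw [h1, h2, RCLike.inner_apply, mul_comm]

theorem integral_norm_sq_fourier {f : ℝ → ℂ} (hf : Integrable f) (hf2 : MemLp f 2) :
    ∫ ξ, ‖𝓕 f ξ‖ ^ 2 = ∫ x, ‖f x‖ ^ 2 := by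
  have h := integral_conj_fourier_mul_fourier hf hf2 hf hf2
  simp only [Complex.conj_mul', ← Complex.ofReal_pow] at h
  rw [integral_complex_ofReal, integral_complex_ofReal] at h
  exact_mod_cast h

section Shift

variable {E : Type*} [NormedAddCommGroup E]

theorem integrableOn_Ioi_comp_add_right {G : ℝ → E} {a q : ℝ}
    (hG : IntegrableOn G (Ioi (a + q))) : IntegrableOn (fun t => G (t + q)) (Ioi a) := by
  have h := (measurePreserving_add_right volume q).integrableOn_comp_preimage
    (measurableEmbedding_addRight q) (f := G) (s := Ioi (a + q))
  simpa [Function.comp_def] using h.2 hG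

theorem integral_Ioi_comp_add_right [NormedSpace ℝ E] (G : ℝ → E) (a q : ℝ) :
    ∫ t in Ioi a, G (t + q) = ∫ t in Ioi (a + q), G t := by
  have h := (measurePreserving_add_right volume q).setIntegral_preimage_emb
    (measurableEmbedding_addRight q) G (Ioi (a + q))
  simpa using h

theorem integral_Ioi_eq_add_shift [NormedSpace ℝ E] {G : ℝ → E} {q : ℝ} (hq : 0 ≤ q)
    (hG : IntegrableOn G (Ioi 0)) :
    ∫ t in Ioi 0, G t = (∫ t in Ioc 0 q, G t) + ∫ t in Ioi 0, G (t + q) := by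
  rw [integral_Ioi_comp_add_right, zero_add, ← setIntegral_union Ioc_disjoint_Ioi_same
    measurableSet_Ioi (hG.mono_set Ioc_subset_Ioi_self)
    (hG.mono_set (Ioi_subset_Ioi hq)), Ioc_union_Ioi_eq_Ioi hq]

end Shift

/-- A nonnegative nonincreasing integrable kernel on the half line. -/
structure DecreasingKernel (β : ℝ → ℝ) : Prop where
  anti : AntitoneOn β (Ioi 0)
  nonneg : ∀ t > 0, 0 ≤ β t
  int : IntegrableOn β (Ioi 0)

namespace DecreasingKernel

variable {β : ℝ → ℝ} {q ω : ℝ}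

theorem shift (h : DecreasingKernel β) (hq : 0 ≤ q) : DecreasingKernel (fun t => β (t + q)) where
  anti := fun x hx y hy hxy => h.anti (show 0 < x + q by have : 0 < x := hx; linarith)
    (show 0 < y + q by have : 0 < y := hy; linarith) (by linarith)
  nonneg := fun t ht => h.nonneg _ (by linarith)
  int := integrableOn_Ioi_comp_add_right (h.int.mono_set (Ioi_subset_Ioi (by linarith)))

theorem sub_shift (h : DecreasingKernel β) (hc : ConvexOn ℝ (Ioi 0) β) (hq : 0 ≤ q) :
    DecreasingKernel (fun t => β t - β (t + q)) where
  anti := by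
    intro x hx y hy hxy
    have hx' : 0 < x := hx
    have hy' : 0 < y := hy
    rcases hxy.eq_or_lt with rfl | hlt
    · exact le_rfl
    have hL : 0 < y - x + q := by linarith
    have e1 : 0 ≤ q / (y - x + q) := by positivity
    have e2 : 0 ≤ (y - x) / (y - x + q) := div_nonneg (by linarith) hL.le
    have e3 : q / (y - x + q) + (y - x) / (y - x + q) = 1 := by field_simp; ring
    have h1 := hc.2 hx (show y + q ∈ Ioi (0 : ℝ) from (show 0 < y + q by linarith)) e1 e2 e3
    have h2 := hc.2 hx (show y + q ∈ Ioi (0 : ℝ) from (show 0 < y + q by linarith)) e2 e1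
      (by linarith)
    simp only [smul_eq_mul] at h1 h2
    rw [show q / (y - x + q) * x + (y - x) / (y - x + q) * (y + q) = y by field_simp; ring] at h1
    rw [show (y - x) / (y - x + q) * x + q / (y - x + q) * (y + q) = x + q by
      field_simp; ring] at h2
    have h3 : (q / (y - x + q) + (y - x) / (y - x + q)) * (β x + β (y + q)) = β x + β (y + q) := by
      rw [e3, one_mul]
    change β y - β (y + q) ≤ β x - β (x + q)
    linarith
  nonneg := fun t ht => sub_nonneg.2 (h.anti ht (show 0 < t + q by linarith) (by linarith))
  int := h.int.sub (h.shift hq).int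

theorem integral_sub_shift (h : DecreasingKernel β) (hq : 0 ≤ q) :
    ∫ t in Ioi 0, (β t - β (t + q)) = ∫ t in Ioc 0 q, β t := by
  rw [integral_sub h.int (h.shift hq).int, integral_Ioi_eq_add_shift hq h.int]
  ring

theorem integrable_mul_bdd (h : DecreasingKernel β) {g : ℝ → ℝ} (hg : Continuous g)
    (hb : ∀ t, |g t| ≤ 1) : IntegrableOn (fun t => β t * g t) (Ioi 0) :=
  h.int.mul_bdd (c := 1) hg.aestronglyMeasurable (.of_forall fun t => by simpa using hb t)

theorem integrable_mul_sin (h : DecreasingKernel β) :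
    IntegrableOn (fun t => β t * Real.sin (ω * t)) (Ioi 0) :=
  h.integrable_mul_bdd (by fun_prop) fun _ => Real.abs_sin_le_one _

theorem integrable_mul_cos (h : DecreasingKernel β) :
    IntegrableOn (fun t => β t * Real.cos (ω * t)) (Ioi 0) :=
  h.integrable_mul_bdd (by fun_prop) fun _ => Real.abs_cos_le_one _

theorem sin_split (h : DecreasingKernel β) (hq : 0 ≤ q) (hω : ω * q = Real.pi) :
    ∫ t in Ioi 0, β t * Real.sin (ω * t) = (∫ t in Ioc 0 q, β t * Real.sin (ω * t)) -
      ∫ t in Ioi 0, β (t + q) * Real.sin (ω * t) := by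
  rw [integral_Ioi_eq_add_shift hq h.integrable_mul_sin, sub_eq_add_neg, ← integral_neg]
  congr 2 with t
  rw [mul_add, hω, Real.sin_add_pi, mul_neg]

theorem sin_nonneg_on (hω : ω * q = Real.pi) (hω0 : 0 < ω) {t : ℝ} (ht : t ∈ Ioc 0 q) :
    0 ≤ Real.sin (ω * t) := by
  refine Real.sin_nonneg_of_nonneg_of_le_pi (mul_nonneg hω0.le ht.1.le) ?_
  rw [← hω]
  exact mul_le_mul_of_nonneg_left ht.2 hω0.le

theorem sin_ge_neg_tail (hω0 : 0 < ω) (hq : 0 < q) (hω : ω * q = Real.pi) (m : ℕ) :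
    ∀ {β : ℝ → ℝ}, DecreasingKernel β →
    -∫ t in Ioi (m * (2 * q)), β t ≤ ∫ t in Ioi 0, β t * Real.sin (ω * t) := by
  induction m with
  | zero =>
    intro β h
    simp only [Nat.cast_zero, zero_mul]
    rw [← integral_neg]
    refine setIntegral_mono_on h.int.neg h.integrable_mul_sin measurableSet_Ioi fun t ht => ?_
    have := Real.neg_one_le_sin (ω * t)
    nlinarith [h.nonneg t ht]
  | succ m ih =>
    intro β h
    have h1 := h.sin_split hq.le hω
    have h2 := (h.shift hq.le).sin_split hq.le hω
    have h3 := ih ((h.shift hq.le).shift hq.le)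
    have h4 : ∫ t in Ioi (m * (2 * q)), β (t + q + q) =
        ∫ t in Ioi ((m + 1 : ℕ) * (2 * q)), β t := by
      have := integral_Ioi_comp_add_right β (m * (2 * q)) (2 * q)
      rw [show (m : ℝ) * (2 * q) + 2 * q = ((m + 1 : ℕ) : ℝ) * (2 * q) by push_cast; ring] at this
      rw [← this]
      congr with t
      ring_nf
    have h5 : ∫ t in Ioc 0 q, β (t + q) * Real.sin (ω * t) ≤
        ∫ t in Ioc 0 q, β t * Real.sin (ω * t) := by
      refine setIntegral_mono_on ((h.shift hq.le).integrable_mul_sin.mono_set Ioc_subset_Ioi_self)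
        (h.integrable_mul_sin.mono_set Ioc_subset_Ioi_self) measurableSet_Ioc fun t ht => ?_
      refine mul_le_mul_of_nonneg_right ?_ (sin_nonneg_on hω hω0 ht)
      exact h.anti ht.1 (show 0 < t + q by have := ht.1; linarith) (by linarith)
    rw [h4] at h3
    linarith

theorem sin_nonneg (h : DecreasingKernel β) (hω0 : 0 < ω) :
    0 ≤ ∫ t in Ioi 0, β t * Real.sin (ω * t) := by
  set q := Real.pi / ω with hqd
  have hq : 0 < q := by positivity
  have hω : ω * q = Real.pi := by rw [hqd]; field_simp
  have ht : Tendsto (fun m : ℕ => (m : ℝ) * (2 * q)) atTop atTop :=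
    tendsto_natCast_atTop_atTop.atTop_mul_const (by positivity)
  have h1 : Tendsto (fun m : ℕ => -∫ t in Ioi ((m : ℝ) * (2 * q)), β t) atTop (nhds 0) := by
    have h2 := intervalIntegral_tendsto_integral_Ioi 0 h.int ht
    have h3 := (tendsto_const_nhds (x := ∫ t in Ioi 0, β t)).sub h2
    rw [sub_self] at h3
    have h4 := h3.neg
    rw [neg_zero] at h4
    refine h4.congr fun m => ?_
    have hm : (0 : ℝ) ≤ m * (2 * q) := by positivity
    rw [intervalIntegral.integral_of_le hm, ← Ioc_union_Ioi_eq_Ioi hm,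
      setIntegral_union Ioc_disjoint_Ioi_same measurableSet_Ioi
        (h.int.mono_set Ioc_subset_Ioi_self) (h.int.mono_set (Ioi_subset_Ioi hm))]
    ring
  exact le_of_tendsto h1 (.of_forall fun m => sin_ge_neg_tail hω0 hq hω m h)

theorem sin_le (h : DecreasingKernel β) (hω0 : 0 < ω) (hω : ω * q = Real.pi) (hq : 0 ≤ q) :
    ∫ t in Ioi 0, β t * Real.sin (ω * t) ≤ ∫ t in Ioc 0 q, β t * Real.sin (ω * t) := by
  rw [h.sin_split hq hω]
  linarith [(h.shift hq).sin_nonneg hω0]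

theorem half_le_sin (h : DecreasingKernel β) (hc : ConvexOn ℝ (Ioi 0) β) (hω0 : 0 < ω)
    (hω : ω * q = Real.pi) (hq : 0 ≤ q) :
    (∫ t in Ioc 0 q, β t * Real.sin (ω * t)) ≤ 2 * ∫ t in Ioi 0, β t * Real.sin (ω * t) := by
  have h1 := h.sin_split hq hω
  have h2 := (h.sub_shift hc hq).sin_nonneg hω0
  simp only [sub_mul] at h2
  rw [integral_sub h.integrable_mul_sin (h.shift hq).integrable_mul_sin] at h2
  linarith

theorem integral_sin_Ioc (hω0 : 0 < ω) {r : ℝ} (hr : 0 ≤ r) :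
    ∫ t in Ioc 0 r, Real.sin (ω * t) = (1 - Real.cos (ω * r)) / ω := by
  rw [← intervalIntegral.integral_of_le hr,
    intervalIntegral.integral_comp_mul_left (fun x => Real.sin x) hω0.ne']
  simp [integral_sin]
  field_simp

/-- For a convex decreasing kernel, the mass near the origin is controlled by the cosine and sine
transforms. -/
theorem integral_Ioc_le_cos_sin (h : DecreasingKernel β) (hc : ConvexOn ℝ (Ioi 0) β)
    (hω0 : 0 < ω) :
    ∫ t in Ioc 0 (1 / ω), β t ≤ 2 * (∫ t in Ioi 0, β t * Real.cos (ω * t)) +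
      8 * ∫ t in Ioi 0, β t * Real.sin (ω * t) := by
  set p := Real.pi / (2 * ω) with hpd
  have hp : 0 < p := by positivity
  have hωp : ω * p = Real.pi / 2 := by rw [hpd]; field_simp
  have hω : ω * (2 * p) = Real.pi := by linarith
  have hint : IntegrableOn (fun t => Real.sin (ω * t)) (Ioc 0 (2 * p)) :=
    (Continuous.integrableOn_Icc (by fun_prop)).mono_set Ioc_subset_Icc_self
  have hp2 : p ≤ 2 * p := by linarith
  have hβp : 0 ≤ β p := h.nonneg p hp
  have hsin : β p / ω ≤ ∫ t in Ioc 0 (2 * p), β t * Real.sin (ω * t) := by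
    calc β p / ω = ∫ t in Ioc 0 p, β p * Real.sin (ω * t) := by
          rw [integral_const_mul, integral_sin_Ioc hω0 hp.le, hωp]; simp; ring
      _ ≤ ∫ t in Ioc 0 p, β t * Real.sin (ω * t) := by
          refine setIntegral_mono_on ((hint.mono_set (Ioc_subset_Ioc_right hp2)).const_mul _)
            (h.integrable_mul_sin.mono_set Ioc_subset_Ioi_self) measurableSet_Ioc fun t ht => ?_
          exact mul_le_mul_of_nonneg_right (h.anti ht.1 hp ht.2)
            (sin_nonneg_on hω hω0 ⟨ht.1, ht.2.trans hp2⟩)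
      _ ≤ _ := by
          refine setIntegral_mono_set (h.integrable_mul_sin.mono_set Ioc_subset_Ioi_self) ?_
            (LE.le.eventuallyLE (Ioc_subset_Ioc_right hp2))
          refine (ae_restrict_iff' measurableSet_Ioc).2 (.of_forall fun t ht => ?_)
          exact mul_nonneg (h.nonneg t ht.1) (sin_nonneg_on hω hω0 ht)
  have hcos : (∫ t in Ioc 0 p, β t * Real.cos (ω * t)) - 2 * (β p / ω) ≤
      ∫ t in Ioi 0, β t * Real.cos (ω * t) := by
    rw [integral_Ioi_eq_add_shift hp.le h.integrable_mul_cos]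
    have h1 : ∫ t in Ioi 0, β (t + p) * Real.cos (ω * (t + p)) =
        -∫ t in Ioi 0, β (t + p) * Real.sin (ω * t) := by
      rw [← integral_neg]
      congr with t
      rw [mul_add, hωp, Real.cos_add_pi_div_two, mul_neg]
    have h2 := (h.shift hp.le).sin_le hω0 hω (by linarith)
    have h3 : ∫ t in Ioc 0 (2 * p), β (t + p) * Real.sin (ω * t) ≤ 2 * (β p / ω) := by
      calc _ ≤ ∫ t in Ioc 0 (2 * p), β p * Real.sin (ω * t) := by
            refine setIntegral_mono_on
              ((h.shift hp.le).integrable_mul_sin.mono_set Ioc_subset_Ioi_self)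
              (hint.const_mul _) measurableSet_Ioc fun t ht => ?_
            refine mul_le_mul_of_nonneg_right ?_ (sin_nonneg_on hω hω0 ht)
            exact h.anti hp (show 0 < t + p by have := ht.1; linarith) (by linarith [ht.1])
        _ = 2 * (β p / ω) := by
            rw [integral_const_mul, integral_sin_Ioc hω0 (by linarith), hω]
            simp; ring
    rw [h1]
    linarith
  have hlow : (∫ t in Ioc 0 (1 / ω), β t) / 2 ≤ ∫ t in Ioc 0 p, β t * Real.cos (ω * t) := by
    have hle : 1 / ω ≤ p := by
      rw [hpd, div_le_div_iff₀ hω0 (by positivity)]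
      nlinarith [Real.pi_gt_three]
    have hcosnn : ∀ t ∈ Ioc 0 p, 0 ≤ Real.cos (ω * t) := fun t ht =>
      Real.cos_nonneg_of_neg_pi_div_two_le_of_le
        (by have := mul_pos hω0 ht.1; linarith [Real.pi_pos])
        (by rw [← hωp]; exact mul_le_mul_of_nonneg_left ht.2 hω0.le)
    calc _ = ∫ t in Ioc 0 (1 / ω), β t * (1 / 2) := by rw [integral_mul_const]; ring
      _ ≤ ∫ t in Ioc 0 (1 / ω), β t * Real.cos (ω * t) := by
        refine setIntegral_mono_on ((h.int.mono_set Ioc_subset_Ioi_self).mul_const _)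
          (h.integrable_mul_cos.mono_set Ioc_subset_Ioi_self) measurableSet_Ioc fun t ht => ?_
        refine mul_le_mul_of_nonneg_left ?_ (h.nonneg t ht.1)
        have h1 := Real.one_sub_sq_div_two_le_cos (x := ω * t)
        have h2 : ω * t ≤ 1 := by
          have := (le_div_iff₀ hω0).1 ht.2
          linarith
        have h3 : 0 < ω * t := mul_pos hω0 ht.1
        nlinarith
      _ ≤ _ := by
        refine setIntegral_mono_set (h.integrable_mul_cos.mono_set Ioc_subset_Ioi_self) ?_
          (LE.le.eventuallyLE (Ioc_subset_Ioc_right hle))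
        refine (ae_restrict_iff' measurableSet_Ioc).2 (.of_forall fun t ht => ?_)
        exact mul_nonneg (h.nonneg t ht.1) (hcosnn t ht)
  have := h.half_le_sin hc hω0 hω (by linarith)
  linarith

end DecreasingKernel

/-- The one-sided Fourier integral of a real function. -/
def osc (ω : ℝ) (f : ℝ → ℝ) : ℂ :=
  ∫ t in Ioi (0 : ℝ), (f t : ℂ) * Complex.exp (-(ω * t) * Complex.I)

section Osc

variable {f g : ℝ → ℝ} {ω q : ℝ}

theorem norm_exp_neg_mul_I (ω t : ℝ) : ‖Complex.exp (-(ω * t) * Complex.I)‖ = 1 := by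
  simpa using Complex.norm_exp_ofReal_mul_I (-(ω * t))

theorem integrableOn_mul_exp_I {s : Set ℝ} (hf : IntegrableOn f s) :
    IntegrableOn (fun t : ℝ => (f t : ℂ) * Complex.exp (-(ω * t) * Complex.I)) s :=
  Integrable.mul_bdd (c := 1) hf.ofReal
    (Continuous.aestronglyMeasurable (by fun_prop))
    (.of_forall fun t => (norm_exp_neg_mul_I ω t).le)

theorem osc_add (hf : IntegrableOn f (Ioi 0)) (hg : IntegrableOn g (Ioi 0)) :
    osc ω (fun t => f t + g t) = osc ω f + osc ω g := by
  unfold osc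
  rw [← integral_add (integrableOn_mul_exp_I hf) (integrableOn_mul_exp_I hg)]
  congr with t
  push_cast
  ring

theorem osc_const_mul (c : ℝ) : osc ω (fun t => c * f t) = c * osc ω f := by
  unfold osc
  rw [← integral_const_mul]
  congr with t
  push_cast
  ring

theorem osc_neg : osc (-ω) f = (starRingEnd ℂ) (osc ω f) := by
  unfold osc
  rw [← integral_conj]
  congr with t
  simp [← Complex.exp_conj]

theorem osc_re (hf : IntegrableOn f (Ioi 0)) :
    (osc ω f).re = ∫ t in Ioi 0, f t * Real.cos (ω * t) := by
  unfold osc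
  have := integral_re (integrableOn_mul_exp_I (ω := ω) hf)
  simp only [RCLike.re_to_complex] at this
  rw [← this]
  congr with t
  rw [Complex.re_ofReal_mul, ← Complex.ofReal_mul, ← Complex.ofReal_neg,
    Complex.exp_ofReal_mul_I_re, Real.cos_neg]

theorem osc_im (hf : IntegrableOn f (Ioi 0)) :
    (osc ω f).im = -∫ t in Ioi 0, f t * Real.sin (ω * t) := by
  unfold osc
  have := integral_im (integrableOn_mul_exp_I (ω := ω) hf)
  simp only [RCLike.im_to_complex] at this
  rw [← this, ← integral_neg]
  congr with t
  rw [Complex.im_ofReal_mul, ← Complex.ofReal_mul, ← Complex.ofReal_neg,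
    Complex.exp_ofReal_mul_I_im, Real.sin_neg]
  ring

theorem norm_integral_mul_exp_I_le {s : Set ℝ} (hs : MeasurableSet s) (h0 : ∀ t ∈ s, 0 ≤ f t) :
    ‖∫ t in s, (f t : ℂ) * Complex.exp (-(ω * t) * Complex.I)‖ ≤ ∫ t in s, f t := by
  refine (norm_integral_le_integral_norm _).trans_eq (setIntegral_congr_fun hs fun t ht => ?_)
  simp only [norm_mul, norm_exp_neg_mul_I, Complex.norm_real, Real.norm_eq_abs, mul_one]
  exact abs_of_nonneg (h0 t ht)

theorem two_mul_osc (hf : IntegrableOn f (Ioi 0)) (hq : 0 ≤ q)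
    (hω : Complex.exp (-(ω * q) * Complex.I) = -1) :
    2 * osc ω f = (∫ t in Ioc 0 q, (f t : ℂ) * Complex.exp (-(ω * t) * Complex.I)) +
      osc ω (fun t => f t - f (t + q)) := by
  have hfq : IntegrableOn (fun t => f (t + q)) (Ioi 0) :=
    integrableOn_Ioi_comp_add_right (hf.mono_set (Ioi_subset_Ioi (by linarith)))
  have h1 := integral_Ioi_eq_add_shift hq (integrableOn_mul_exp_I (ω := ω) hf)
  have h2 : ∫ t in Ioi (0 : ℝ), (f (t + q) : ℂ) *
      Complex.exp (-(ω * ((t + q : ℝ) : ℂ)) * Complex.I) = -osc ω (fun t => f (t + q)) := by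
    unfold osc
    rw [← integral_neg]
    congr with t
    rw [show -(ω * ((t + q : ℝ) : ℂ)) * Complex.I =
      -(ω * t) * Complex.I + -(ω * q) * Complex.I by push_cast; ring, Complex.exp_add, hω]
    ring
  have h3 : osc ω (fun t => f t - f (t + q)) = osc ω f - osc ω (fun t => f (t + q)) := by
    have := osc_add (ω := ω) hf (hfq.const_mul (-1))
    rw [osc_const_mul] at this
    simp only [neg_one_mul, ← sub_eq_add_neg] at this
    rw [this]
    push_cast
    ring
  rw [h2] at h1
  rw [h3]
  change osc ω f = _ at h1
  linear_combination h1

end Osc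

namespace DecreasingKernel

variable {β : ℝ → ℝ} {q ω : ℝ}

theorem norm_osc_le (h : DecreasingKernel β) (hq : 0 ≤ q)
    (hω : Complex.exp (-(ω * q) * Complex.I) = -1) : ‖osc ω β‖ ≤ ∫ t in Ioc 0 q, β t := by
  have h1 := two_mul_osc h.int hq hω
  have h2 := norm_integral_mul_exp_I_le (ω := ω) (s := Ioc 0 q) measurableSet_Ioc
    fun t ht => h.nonneg t ht.1
  have h3 : ‖osc ω (fun t => β t - β (t + q))‖ ≤ _ :=
    norm_integral_mul_exp_I_le (ω := ω) (s := Ioi 0) measurableSet_Ioi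
      fun t ht => sub_nonneg.2 (h.anti ht (show 0 < t + q by have : 0 < t := ht; linarith)
        (by linarith))
  rw [h.integral_sub_shift hq] at h3
  have h4 := congrArg norm h1
  rw [norm_mul, Complex.norm_ofNat] at h4
  linarith [norm_add_le (∫ t in Ioc 0 q, (β t : ℂ) * Complex.exp (-(ω * t) * Complex.I))
    (osc ω (fun t => β t - β (t + q)))]

theorem integral_Ioc_shift_le (h : DecreasingKernel β) (hq : 0 ≤ q) :
    ∫ t in Ioc 0 q, β (t + q) ≤ ∫ t in Ioc 0 q, β t :=
  setIntegral_mono_on ((h.shift hq).int.mono_set Ioc_subset_Ioi_self)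
    (h.int.mono_set Ioc_subset_Ioi_self) measurableSet_Ioc fun t ht =>
      h.anti ht.1 (show 0 < t + q by have := ht.1; linarith) (by linarith)

theorem integrable_id_mul_shift (h : DecreasingKernel β)
    (ht : IntegrableOn (fun t => t * β t) (Ioi 0)) (hq : 0 ≤ q) :
    IntegrableOn (fun t => t * β (t + q)) (Ioi 0) := by
  have h1 : IntegrableOn (fun t => (t + q) * β (t + q)) (Ioi 0) :=
    integrableOn_Ioi_comp_add_right (G := fun t => t * β t)
      (ht.mono_set (Ioi_subset_Ioi (by linarith)))
  refine (h1.sub ((h.shift hq).int.const_mul q)).congr (.of_forall fun t => ?_)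
  simp only [Pi.sub_apply]
  ring

theorem integral_Ioc_id_mul_le (h : DecreasingKernel β)
    (ht : IntegrableOn (fun t => t * β t) (Ioi 0)) :
    ∫ t in Ioc 0 q, t * β t ≤ q * ∫ t in Ioc 0 q, β t := by
  rw [← integral_const_mul]
  exact setIntegral_mono_on (ht.mono_set Ioc_subset_Ioi_self)
    ((h.int.mono_set Ioc_subset_Ioi_self).const_mul _) measurableSet_Ioc fun t ht =>
      mul_le_mul_of_nonneg_right ht.2 (h.nonneg t ht.1)

theorem two_mul_osc_id_mul (h : DecreasingKernel β)
    (ht : IntegrableOn (fun t => t * β t) (Ioi 0)) (hq : 0 ≤ q)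
    (hω : Complex.exp (-(ω * q) * Complex.I) = -1) :
    2 * osc ω (fun t => t * β t) =
      (∫ t in Ioc 0 q, ((t * β t : ℝ) : ℂ) * Complex.exp (-(ω * t) * Complex.I)) +
      osc ω (fun t => t * (β t - β (t + q))) - q * osc ω (fun t => β (t + q)) := by
  rw [two_mul_osc ht hq hω]
  have h1 := osc_add (ω := ω) (f := fun t => t * (β t - β (t + q)))
    (g := fun t => (-q) * β (t + q))
    (((ht.sub (h.integrable_id_mul_shift ht hq))).congr
      (.of_forall fun t => by simp only [Pi.sub_apply]; ring))
    ((h.shift hq).int.const_mul _)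
  rw [osc_const_mul] at h1
  have h2 : (fun t => t * β t - (t + q) * β (t + q)) =
    fun t => t * (β t - β (t + q)) + -q * β (t + q) := by ext t; ring
  rw [h2, h1]
  push_cast
  ring

theorem norm_osc_id_mul_le (h : DecreasingKernel β) (hc : ConvexOn ℝ (Ioi 0) β)
    (ht : IntegrableOn (fun t => t * β t) (Ioi 0)) (hq : 0 ≤ q)
    (hω : Complex.exp (-(ω * q) * Complex.I) = -1) :
    ‖osc ω (fun t => t * β t)‖ ≤ 2 * q * ∫ t in Ioc 0 q, β t := by
  have hδ := h.sub_shift hc hq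
  have htδ : IntegrableOn (fun t => t * (β t - β (t + q))) (Ioi 0) :=
    (ht.sub (h.integrable_id_mul_shift ht hq)).congr
      (.of_forall fun t => by simp only [Pi.sub_apply]; ring)
  set δ : ℝ → ℝ := fun t => β t - β (t + q) with hδd
  have hβi := h.int.mono_set (Ioc_subset_Ioi_self : Ioc 0 q ⊆ Ioi 0)
  have hβqi := (h.shift hq).int.mono_set (Ioc_subset_Ioi_self : Ioc 0 q ⊆ Ioi 0)
  have b1 := h.integral_Ioc_shift_le hq
  have b1n : 0 ≤ ∫ t in Ioc 0 q, β (t + q) :=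
    setIntegral_nonneg measurableSet_Ioc fun t ht => (h.shift hq).nonneg t ht.1
  have dI : ∫ t in Ioc 0 q, δ t = (∫ t in Ioc 0 q, β t) - ∫ t in Ioc 0 q, β (t + q) :=
    integral_sub hβi hβqi
  have e1 := h.two_mul_osc_id_mul ht hq hω
  have e2 := hδ.two_mul_osc_id_mul htδ hq hω
  have n1 := norm_integral_mul_exp_I_le (ω := ω) (s := Ioc 0 q) (f := fun t => t * β t)
    measurableSet_Ioc fun t ht => mul_nonneg ht.1.le (h.nonneg t ht.1)
  have n2 := norm_integral_mul_exp_I_le (ω := ω) (s := Ioc 0 q) (f := fun t => t * δ t)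
    measurableSet_Ioc fun t ht => mul_nonneg ht.1.le (hδ.nonneg t ht.1)
  have n3 : ‖osc ω (fun t => t * (δ t - δ (t + q)))‖ ≤
      ∫ t in Ioi 0, t * (δ t - δ (t + q)) :=
    norm_integral_mul_exp_I_le (ω := ω) (s := Ioi 0) measurableSet_Ioi fun t ht =>
      mul_nonneg (le_of_lt ht) (sub_nonneg.2 (hδ.anti ht
        (show 0 < t + q by have : 0 < t := ht; linarith) (by linarith)))
  have n4 := (h.shift hq).norm_osc_le hq hω
  have n5 := (hδ.shift hq).norm_osc_le hq hω
  have m1 := h.integral_Ioc_id_mul_le ht (q := q)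
  have m2 := hδ.integral_Ioc_id_mul_le htδ (q := q)
  have m3 := hδ.integral_Ioc_shift_le hq
  have i1 : ∫ t in Ioi 0, δ (t + q) = ∫ t in Ioc 0 q, β (t + q) := by
    have h1 := integral_Ioi_eq_add_shift hq hδ.int
    have h2 := h.integral_sub_shift hq
    change ∫ t in Ioi 0, δ t = _ at h2
    linarith
  have i2 : ∫ t in Ioi 0, t * (δ t - δ (t + q)) =
      (∫ t in Ioc 0 q, t * δ t) + q * ∫ t in Ioc 0 q, β (t + q) := by
    have h1 := integral_Ioi_eq_add_shift hq htδ
    have h2 : ∫ t in Ioi 0, (t + q) * δ (t + q) =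
        (∫ t in Ioi 0, t * δ (t + q)) + q * ∫ t in Ioi 0, δ (t + q) := by
      rw [← integral_const_mul, ← integral_add (hδ.integrable_id_mul_shift htδ hq)
        ((hδ.shift hq).int.const_mul _)]
      congr with t
      ring
    have h3 : ∫ t in Ioi 0, t * (δ t - δ (t + q)) =
        (∫ t in Ioi 0, t * δ t) - ∫ t in Ioi 0, t * δ (t + q) := by
      rw [← integral_sub htδ (hδ.integrable_id_mul_shift htδ hq)]
      congr with t
      ring
    rw [h3, h1, h2, i1]
    ring
  rw [i2] at n3
  have E1 := congrArg norm e1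
  have E2 := congrArg norm e2
  rw [norm_mul, Complex.norm_ofNat] at E1 E2
  have t1 := norm_sub_le ((∫ t in Ioc 0 q, ((t * β t : ℝ) : ℂ) *
    Complex.exp (-(ω * t) * Complex.I)) + osc ω (fun t => t * δ t))
    (q * osc ω (fun t => β (t + q)))
  have t1' := norm_add_le (∫ t in Ioc 0 q, ((t * β t : ℝ) : ℂ) *
    Complex.exp (-(ω * t) * Complex.I)) (osc ω (fun t => t * δ t))
  have t2 := norm_sub_le ((∫ t in Ioc 0 q, ((t * δ t : ℝ) : ℂ) *
    Complex.exp (-(ω * t) * Complex.I)) + osc ω (fun t => t * (δ t - δ (t + q))))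
    (q * osc ω (fun t => δ (t + q)))
  have t2' := norm_add_le (∫ t in Ioc 0 q, ((t * δ t : ℝ) : ℂ) *
    Complex.exp (-(ω * t) * Complex.I)) (osc ω (fun t => t * (δ t - δ (t + q))))
  rw [norm_mul, Complex.norm_real, Real.norm_eq_abs, abs_of_nonneg hq] at t1 t2
  have p4 := mul_le_mul_of_nonneg_left (n4.trans b1) hq
  have p5 := mul_le_mul_of_nonneg_left (n5.trans m3) hq
  have p6 := mul_nonneg hq b1n
  have p7 := mul_le_mul_of_nonneg_left b1 hq
  simp only [dI] at *
  rw [mul_sub] at *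
  linarith

theorem integral_Ioc_mul_le (h : DecreasingKernel β) {c r : ℝ} (hc : 1 ≤ c) (hr : 0 ≤ r) :
    ∫ t in Ioc 0 (c * r), β t ≤ c * ∫ t in Ioc 0 r, β t := by
  have hc0 : 0 < c := by linarith
  have h1 := intervalIntegral.integral_comp_mul_left (a := 0) (b := r) β hc0.ne'
  rw [mul_zero, smul_eq_mul, eq_inv_mul_iff_mul_eq₀ hc0.ne',
    intervalIntegral.integral_of_le hr, intervalIntegral.integral_of_le (by positivity)] at h1
  rw [← h1]
  refine mul_le_mul_of_nonneg_left ?_ hc0.le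
  have h2 : IntegrableOn (fun t => β (c * t)) (Ioi 0) := by
    rw [integrableOn_Ioi_comp_mul_left_iff _ _ hc0]
    simpa using h.int
  refine setIntegral_mono_on (h2.mono_set Ioc_subset_Ioi_self)
    (h.int.mono_set Ioc_subset_Ioi_self) measurableSet_Ioc fun t ht => ?_
  exact h.anti ht.1 (show 0 < c * t from mul_pos hc0 ht.1) (by nlinarith [ht.1])

theorem integral_Ioc_le_norm_osc (h : DecreasingKernel β) (hc : ConvexOn ℝ (Ioi 0) β)
    (hω0 : ω ≠ 0) : ∫ t in Ioc 0 (1 / |ω|), β t ≤ 10 * ‖osc ω β‖ := by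
  wlog hω : 0 < ω generalizing ω
  · have := this (neg_ne_zero.2 hω0) (neg_pos.2 ((not_lt.1 hω).lt_of_ne hω0))
    rwa [abs_neg, osc_neg, Complex.norm_conj] at this
  have h1 := h.integral_Ioc_le_cos_sin hc hω
  rw [abs_of_pos hω]
  have h2 := Complex.abs_re_le_norm (osc ω β)
  have h3 := Complex.abs_im_le_norm (osc ω β)
  rw [osc_re h.int] at h2
  rw [osc_im h.int, abs_neg] at h3
  linarith [le_abs_self (∫ t in Ioi 0, β t * Real.cos (ω * t)),
    le_abs_self (∫ t in Ioi 0, β t * Real.sin (ω * t))]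

theorem abs_mul_norm_osc_id_mul_le (h : DecreasingKernel β) (hc : ConvexOn ℝ (Ioi 0) β)
    (ht : IntegrableOn (fun t => t * β t) (Ioi 0)) :
    |ω| * ‖osc ω (fun t => t * β t)‖ ≤ 200 * ‖osc ω β‖ := by
  rcases eq_or_ne ω 0 with rfl | hω0
  · simp
  have ha : 0 < |ω| := abs_pos.2 hω0
  have hω : Complex.exp (-(ω * (Real.pi * (1 / |ω|) : ℝ)) * Complex.I) = -1 := by
    rcases abs_choice ω with hh | hh
    · rw [hh, show -(ω * ((Real.pi * (1 / ω) : ℝ) : ℂ)) * Complex.I = -(Real.pi * Complex.I) by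
        have : (ω : ℂ) ≠ 0 := by exact_mod_cast hω0
        push_cast; field_simp, Complex.exp_neg, Complex.exp_pi_mul_I]
      norm_num
    · rw [hh, show -(ω * ((Real.pi * (1 / -ω) : ℝ) : ℂ)) * Complex.I = Real.pi * Complex.I by
        have : (ω : ℂ) ≠ 0 := by exact_mod_cast hω0
        push_cast; field_simp, Complex.exp_pi_mul_I]
  have h1 := h.norm_osc_id_mul_le hc ht (q := Real.pi * (1 / |ω|)) (by positivity) hω
  have h2 := h.integral_Ioc_mul_le (c := Real.pi) (r := 1 / |ω|)
    (by linarith [Real.pi_gt_three]) (by positivity)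
  have h3 := h.integral_Ioc_le_norm_osc hc hω0
  have h0 : 0 ≤ ∫ t in Ioc 0 (1 / |ω|), β t :=
    setIntegral_nonneg measurableSet_Ioc fun t ht => h.nonneg t ht.1
  have hpi : Real.pi * Real.pi ≤ 10 := by nlinarith [Real.pi_lt_d2, Real.pi_gt_three]
  calc |ω| * ‖osc ω (fun t => t * β t)‖
      ≤ |ω| * (2 * (Real.pi * (1 / |ω|)) * (Real.pi * ∫ t in Ioc 0 (1 / |ω|), β t)) :=
        mul_le_mul_of_nonneg_left (h1.trans (mul_le_mul_of_nonneg_left h2 (by positivity))) ha.le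
    _ = 2 * (Real.pi * Real.pi) * ∫ t in Ioc 0 (1 / |ω|), β t := by field_simp
    _ ≤ 20 * ∫ t in Ioc 0 (1 / |ω|), β t := by nlinarith
    _ ≤ _ := by linarith

end DecreasingKernel

namespace Assumption1

variable {b b' : ℝ → ℝ} {ρ η ω : ℝ}

theorem aestronglyMeasurable (hb : Assumption1 b b' ρ) :
    AEStronglyMeasurable b (volume.restrict (Ioi 0)) :=
  ContinuousOn.aestronglyMeasurable
    (fun t ht => (hb.hasDeriv t ht).continuousAt.continuousWithinAt) measurableSet_Ioi

theorem integrableOn_exp_mul (hb : Assumption1 b b' ρ) (hη : 0 < η) :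
    IntegrableOn (fun t => Real.exp (-η * t) * b t) (Ioi 0) := by
  rw [← Ioc_union_Ioi_eq_Ioi zero_le_one]
  refine IntegrableOn.union ?_ ?_
  · refine Integrable.bdd_mul (c := 1) (hb.locInt 1 one_pos)
      (Continuous.aestronglyMeasurable (by fun_prop)) ?_
    refine (ae_restrict_iff' measurableSet_Ioc).2 (.of_forall fun t ht => ?_)
    rw [Real.norm_eq_abs, Real.abs_exp]
    exact Real.exp_le_one_iff.2 (by nlinarith [ht.1])
  · refine Integrable.mul_bdd (c := b 1) (integrableOn_exp_mul_Ioi (by linarith) 1)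
      (hb.aestronglyMeasurable.mono_set (Ioi_subset_Ioi zero_le_one)) ?_
    refine (ae_restrict_iff' measurableSet_Ioi).2 (.of_forall fun t ht => ?_)
    have ht0 : 0 < t := lt_trans one_pos ht
    rw [Real.norm_eq_abs, abs_of_nonneg (hb.nonneg t ht0)]
    exact hb.anti (show (0 : ℝ) < 1 from one_pos) ht0 (le_of_lt ht)

theorem decreasingKernel (hb : Assumption1 b b' ρ) (hη : 0 < η) :
    DecreasingKernel (fun t => Real.exp (-η * t) * b t) where
  anti := fun x hx y hy hxy => mul_le_mul
    (Real.exp_le_exp.2 (by nlinarith)) (hb.anti hx hy hxy) (hb.nonneg y hy) (Real.exp_pos _).le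
  nonneg := fun t ht => mul_nonneg (Real.exp_pos _).le (hb.nonneg t ht)
  int := hb.integrableOn_exp_mul hη

theorem convexOn_exp_mul (hb : Assumption1 b b' ρ) (hη : 0 < η) :
    ConvexOn ℝ (Ioi 0) (fun t => Real.exp (-η * t) * b t) := by
  have h1 : ConvexOn ℝ (Ioi 0) (fun t : ℝ => Real.exp (-η * t)) := by
    have := (convexOn_exp.comp_linearMap (LinearMap.lsmul ℝ ℝ (-η))).subset
      (subset_univ (Ioi (0 : ℝ))) (convex_Ioi 0)
    simpa [Function.comp_def] using this
  refine h1.mul hb.cvx (fun t _ => (Real.exp_pos _).le) (fun t ht => hb.nonneg t ht) ?_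
  refine AntitoneOn.monovaryOn (fun x _ y _ hxy => Real.exp_le_exp.2 (by nlinarith)) hb.anti

theorem integrableOn_id_mul_exp_mul (hb : Assumption1 b b' ρ) (hη : 0 < η) :
    IntegrableOn (fun t => t * (Real.exp (-η * t) * b t)) (Ioi 0) := by
  have h1 : IntegrableOn (fun t => (t * Real.exp (-(η / 2) * t)) *
      (Real.exp (-(η / 2) * t) * b t)) (Ioi 0) := by
    refine Integrable.bdd_mul (c := 2 / η) (hb.integrableOn_exp_mul (half_pos hη))
      (Continuous.aestronglyMeasurable (by fun_prop)) ?_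
    refine (ae_restrict_iff' measurableSet_Ioi).2 (.of_forall fun t ht => ?_)
    have ht0 : 0 < t := ht
    rw [Real.norm_eq_abs, abs_of_nonneg (by positivity), neg_mul, Real.exp_neg,
      ← div_eq_mul_inv, div_le_div_iff₀ (Real.exp_pos _) hη]
    nlinarith [Real.add_one_le_exp (η / 2 * t)]
  refine h1.congr (.of_forall fun t => ?_)
  simp only
  rw [show -η * t = -(η / 2) * t + -(η / 2) * t by ring, Real.exp_add]
  ring

theorem laplaceTransform_eq_osc (b : ℝ → ℝ) (η ω : ℝ) :
    laplaceTransform b (η + ω * Complex.I) = osc ω (fun t => Real.exp (-η * t) * b t) := by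
  unfold laplaceTransform osc
  congr with t
  rw [show -((η : ℂ) + ω * Complex.I) * t = -η * t + -(ω * t) * Complex.I by ring,
    Complex.exp_add]
  push_cast
  ring

theorem mass_pos (hb : Assumption1 b b' ρ) {r : ℝ} (hr : 0 < r) : 0 < ∫ t in Ioc 0 r, b t := by
  obtain ⟨t₀, ht₀, hne⟩ := hb.ne_zero
  have h0 : 0 < b t₀ := (hb.nonneg t₀ ht₀).lt_of_ne' hne
  have hm : 0 < min r t₀ := lt_min hr ht₀
  calc 0 < ∫ _ in Ioc 0 (min r t₀), b t₀ := by
        rw [setIntegral_const]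
        simp only [measureReal_def, Real.volume_Ioc, sub_zero, ENNReal.toReal_ofReal hm.le,
          smul_eq_mul]
        positivity
    _ ≤ ∫ t in Ioc 0 (min r t₀), b t := by
        refine setIntegral_mono_on (by simp) (hb.locInt _ hm) measurableSet_Ioc fun t ht => ?_
        exact hb.anti ht.1 ht₀ (ht.2.trans (min_le_right _ _))
    _ ≤ _ := by
        refine setIntegral_mono_set (hb.locInt r hr) ?_
          (LE.le.eventuallyLE (Ioc_subset_Ioc_right (min_le_left _ _)))
        exact (ae_restrict_iff' measurableSet_Ioc).2 (.of_forall fun t ht => hb.nonneg t ht.1)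

theorem exp_mul_mass_le (hb : Assumption1 b b' ρ) (hη : 0 < η) {r : ℝ} (hr : 0 < r) :
    Real.exp (-η * r) * ∫ t in Ioc 0 r, b t ≤ ∫ t in Ioc 0 r, Real.exp (-η * t) * b t := by
  rw [← integral_const_mul]
  refine setIntegral_mono_on ((hb.locInt r hr).const_mul _)
    ((hb.integrableOn_exp_mul hη).mono_set Ioc_subset_Ioi_self) measurableSet_Ioc fun t ht => ?_
  exact mul_le_mul_of_nonneg_right (Real.exp_le_exp.2 (by nlinarith [ht.2])) (hb.nonneg t ht.1)

theorem mass_le_exp_mul (hb : Assumption1 b b' ρ) (hη : 0 < η) {r : ℝ} (hr : 0 < r) :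
    ∫ t in Ioc 0 r, b t ≤ Real.exp (η * r) * ∫ t in Ioc 0 r, Real.exp (-η * t) * b t := by
  have h := mul_le_mul_of_nonneg_left (hb.exp_mul_mass_le hη hr) (Real.exp_pos (η * r)).le
  rwa [← mul_assoc, ← Real.exp_add, neg_mul, add_neg_cancel, Real.exp_zero, one_mul] at h

theorem laplaceTransform_ne_zero (hb : Assumption1 b b' ρ) {z : ℂ} (hz : 0 < z.re) :
    laplaceTransform b z ≠ 0 := by
  rw [← Complex.re_add_im z, laplaceTransform_eq_osc]
  have hK := hb.decreasingKernel hz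
  intro h0
  rcases eq_or_ne z.im 0 with hω | hω
  · have h1 : (osc z.im fun t => Real.exp (-z.re * t) * b t).re = 0 := by rw [h0]; rfl
    rw [osc_re hK.int, hω] at h1
    simp only [zero_mul, Real.cos_zero, mul_one] at h1
    have h2 := (hb.exp_mul_mass_le hz one_pos)
    have h3 : ∫ t in Ioc 0 1, Real.exp (-z.re * t) * b t ≤
        ∫ t in Ioi 0, Real.exp (-z.re * t) * b t :=
      setIntegral_mono_set hK.int
        ((ae_restrict_iff' measurableSet_Ioi).2 (.of_forall fun t ht => hK.nonneg t ht))
        (LE.le.eventuallyLE Ioc_subset_Ioi_self)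
    have := mul_pos (Real.exp_pos (-z.re * 1)) (hb.mass_pos one_pos)
    linarith
  · have h1 := hK.integral_Ioc_le_norm_osc (hb.convexOn_exp_mul hz) hω
    have h2 := hb.exp_mul_mass_le hz (r := 1 / |z.im|) (by positivity)
    rw [h0, norm_zero, mul_zero] at h1
    have := mul_pos (Real.exp_pos (-z.re * (1 / |z.im|)))
      (hb.mass_pos (r := 1 / |z.im|) (by positivity))
    linarith

theorem abs_arg_le (hb : Assumption1 b b' ρ) {z : ℂ} (hz : 0 < z.re) :
    |(laplaceTransform b z).arg| ≤ (ρ - 1) * Real.pi / 2 := by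
  have hbdd : BddAbove {θ : ℝ | ∃ z : ℂ, 0 < z.re ∧ θ = |(laplaceTransform b z).arg|} :=
    ⟨Real.pi, by rintro _ ⟨z, _, rfl⟩; exact Complex.abs_arg_le_pi _⟩
  have h := le_csSup hbdd ⟨z, hz, rfl⟩
  have h2 := hb.rho_eq
  have : sSup {θ : ℝ | ∃ z : ℂ, 0 < z.re ∧ θ = |(laplaceTransform b z).arg|} =
      (ρ - 1) * Real.pi / 2 := by
    rw [h2]; field_simp; ring
  rwa [this] at h

/-- The cosine of the half opening angle of the range of the Laplace transform. -/
def _root_.sectorCos (ρ : ℝ) : ℝ := Real.cos ((ρ - 1) * Real.pi / 2)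

theorem sectorCos_pos (hb : Assumption1 b b' ρ) : 0 < sectorCos ρ := by
  have h1 := hb.rho_mem.1
  have h2 := hb.rho_mem.2
  refine Real.cos_pos_of_mem_Ioo ⟨?_, ?_⟩ <;> nlinarith [Real.pi_pos]

theorem re_ge (hb : Assumption1 b b' ρ) {z : ℂ} (hz : 0 < z.re) :
    sectorCos ρ * ‖laplaceTransform b z‖ ≤ (laplaceTransform b z).re := by
  have h1 := hb.rho_mem.1
  have h2 := hb.rho_mem.2
  have h := hb.abs_arg_le hz
  rw [← Complex.norm_mul_cos_arg (laplaceTransform b z), mul_comm]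
  refine mul_le_mul_of_nonneg_left ?_ (norm_nonneg _)
  rw [← Real.cos_abs (laplaceTransform b z).arg]
  refine Real.cos_le_cos_of_nonneg_of_le_pi (abs_nonneg _) ?_ h
  nlinarith [Real.pi_pos]

theorem re_nonneg (hb : Assumption1 b b' ρ) {z : ℂ} (hz : 0 < z.re) :
    0 ≤ (laplaceTransform b z).re :=
  (mul_nonneg hb.sectorCos_pos.le (norm_nonneg _)).trans (hb.re_ge hz)

theorem norm_add_ge (hb : Assumption1 b b' ρ) {z : ℂ} (hz : 0 < z.re) {l : ℝ} (hl : 0 ≤ l) :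
    sectorCos ρ * (‖z‖ + l * ‖laplaceTransform b z‖) ≤ 3 * ‖z + l * laplaceTransform b z‖ := by
  have hc := hb.sectorCos_pos
  have hc1 : sectorCos ρ ≤ 1 := Real.cos_le_one _
  set w := laplaceTransform b z
  have h1 : sectorCos ρ * (l * ‖w‖) ≤ ‖z + l * w‖ := by
    refine le_trans ?_ (Complex.re_le_norm _)
    rw [Complex.add_re, Complex.re_ofReal_mul]
    have := mul_le_mul_of_nonneg_left (hb.re_ge hz) hl
    nlinarith
  have h2 : ‖z‖ ≤ ‖z + l * w‖ + l * ‖w‖ := by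
    have := norm_sub_le (z + l * w) (l * w)
    rwa [add_sub_cancel_right, norm_mul, Complex.norm_real, Real.norm_eq_abs,
      abs_of_nonneg hl] at this
  nlinarith [norm_nonneg (z + l * w)]

theorem differentiableAt_laplaceTransform (hb : Assumption1 b b' ρ) {z : ℂ} (hz : 0 < z.re) :
    DifferentiableAt ℂ (laplaceTransform b) z := by
  have hε : 0 < z.re / 2 := by linarith
  have hmeas : ∀ w : ℂ, AEStronglyMeasurable (fun t : ℝ => Complex.exp (-w * t) * (b t : ℂ))
      (volume.restrict (Ioi 0)) := fun w =>
    (Continuous.aestronglyMeasurable (by fun_prop)).mul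
      (Complex.continuous_ofReal.comp_aestronglyMeasurable hb.aestronglyMeasurable)
  have hnorm : ∀ (w : ℂ) (t : ℝ), ‖Complex.exp (-w * t)‖ = Real.exp (-w.re * t) := by
    intro w t
    rw [Complex.norm_exp]
    simp
  have h := hasDerivAt_integral_of_dominated_loc_of_deriv_le
    (μ := volume.restrict (Ioi (0 : ℝ)))
    (F := fun (w : ℂ) (t : ℝ) => Complex.exp (-w * t) * (b t : ℂ))
    (F' := fun (w : ℂ) (t : ℝ) => -t * Complex.exp (-w * t) * (b t : ℂ))
    (bound := fun t => t * (Real.exp (-(z.re / 2) * t) * b t)) (x₀ := z)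
    (Metric.ball_mem_nhds z hε) (.of_forall hmeas) ?_ ?_ ?_
    (hb.integrableOn_id_mul_exp_mul hε) ?_
  · exact h.2.differentiableAt
  · refine Integrable.mono (hb.integrableOn_exp_mul hz) (hmeas z) ((ae_restrict_iff' measurableSet_Ioi).2
      (.of_forall fun t ht => ?_))
    rw [norm_mul, norm_mul, hnorm, Complex.norm_real, Real.norm_eq_abs (Real.exp _),
      Real.abs_exp]
  · exact ((Continuous.aestronglyMeasurable (by fun_prop))).mul
      (Complex.continuous_ofReal.comp_aestronglyMeasurable hb.aestronglyMeasurable)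
  · refine (ae_restrict_iff' measurableSet_Ioi).2 (.of_forall fun t ht w hw => ?_)
    have ht0 : 0 < t := ht
    rw [norm_mul, norm_mul, hnorm, Complex.norm_real, norm_neg, Complex.norm_real,
      Real.norm_eq_abs, Real.norm_eq_abs, abs_of_pos ht0, abs_of_nonneg (hb.nonneg t ht), mul_assoc]
    refine mul_le_mul_of_nonneg_left (mul_le_mul_of_nonneg_right
      (Real.exp_le_exp.2 ?_) (hb.nonneg t ht)) ht0.le
    have h1 : |(w - z).re| < z.re / 2 := (Complex.abs_re_le_norm _).trans_lt
      (by rwa [Metric.mem_ball, dist_eq_norm] at hw)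
    rw [Complex.sub_re] at h1
    nlinarith [(abs_lt.1 h1).1]
  · refine .of_forall fun t w _ => ?_
    have h1 : HasDerivAt (fun w : ℂ => -w * t) (-t) w := by
      simpa using (hasDerivAt_id w).neg.mul_const (t : ℂ)
    have := (h1.cexp).mul_const (b t : ℂ)
    rwa [mul_comm (Complex.exp _)] at this

end Assumption1

theorem re_mul_one_add_div_one_sub_pos {x : ℝ} (hx : 0 < x) {w : ℂ} (hw : ‖w‖ < 1) :
    0 < (x * ((1 + w) / (1 - w))).re := by
  have h1 : (1 - w) ≠ 0 := by
    intro h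
    rw [sub_eq_zero] at h
    rw [← h] at hw
    simp at hw
  have h2 : 0 < Complex.normSq (1 - w) := Complex.normSq_pos.2 h1
  have h3 : w.re * w.re + w.im * w.im < 1 := by
    have := Complex.normSq_eq_norm_sq w
    rw [Complex.normSq_apply] at this
    nlinarith [norm_nonneg w]
  rw [Complex.re_ofReal_mul, Complex.div_re, ← add_div]
  refine mul_pos hx (div_pos ?_ h2)
  simp only [Complex.add_re, Complex.one_re, Complex.sub_re, Complex.add_im, Complex.one_im,
    Complex.sub_im]
  nlinarith

/-- The Schwarz lemma for holomorphic self-maps of the closed right half plane. -/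
theorem mul_le_mul_of_re_nonneg {g : ℂ → ℂ} (hd : ∀ z : ℂ, 0 < z.re → DifferentiableAt ℂ g z)
    (hre : ∀ z : ℂ, 0 < z.re → 0 ≤ (g z).re) {x y G Y : ℝ} (hx : 0 < x) (hxy : x ≤ y)
    (hG : 0 < G) (hY : 0 < Y) (hgx : g x = G) (hgy : g y = Y) : G * x ≤ Y * y := by
  have hy : 0 < y := hx.trans_le hxy
  set ψ : ℂ → ℂ := fun w => x * ((1 + w) / (1 - w)) with hψ
  have hψre : ∀ w ∈ Metric.ball (0 : ℂ) 1, 0 < (ψ w).re := fun w hw =>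
    re_mul_one_add_div_one_sub_pos hx (by simpa using hw)
  have hden : ∀ z : ℂ, 0 < z.re → g z + G ≠ 0 := by
    intro z hz h
    have := congrArg Complex.re h
    simp only [Complex.add_re, Complex.ofReal_re, Complex.zero_re] at this
    linarith [hre z hz]
  have hψd : ∀ w ∈ Metric.ball (0 : ℂ) 1, DifferentiableAt ℂ ψ w := by
    intro w hw
    have h1 : (1 - w) ≠ 0 := by
      intro h
      rw [sub_eq_zero] at h
      rw [← h] at hw
      simp at hw
    fun_prop (disch := assumption)
  have key := Complex.norm_le_norm_of_mapsTo_ball (R := 1)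
    (f := fun w => (g (ψ w) - G) / (g (ψ w) + G)) (z := (((y - x) / (y + x) : ℝ) : ℂ)) ?_ ?_ ?_ ?_
  · have h1 : ψ (((y - x) / (y + x) : ℝ) : ℂ) = y := by
      have hxy' : x + y ≠ 0 := by positivity
      have : (y : ℂ) + x ≠ 0 := by
        rw [add_comm] at hxy'; exact_mod_cast hxy'
      have hx' : (x : ℂ) ≠ 0 := by exact_mod_cast hx.ne'
      simp only [hψ]
      push_cast
      have e1 : 1 + ((y : ℂ) - x) / (y + x) = 2 * y / (y + x) := by field_simp; ring
      have e2 : 1 - ((y : ℂ) - x) / (y + x) = 2 * x / (y + x) := by field_simp; ring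
      rw [e1, e2]
      field_simp
    simp only [h1, hgy] at key
    rw [← Complex.ofReal_sub, ← Complex.ofReal_add, ← Complex.ofReal_div, Complex.norm_real,
      Complex.norm_real, Real.norm_eq_abs, Real.norm_eq_abs,
      abs_of_nonneg (div_nonneg (sub_nonneg.2 hxy) (by positivity))] at key
    have h2 := (abs_le.1 key).1
    rw [← neg_div, div_le_div_iff₀ (by positivity) (by positivity)] at h2
    nlinarith
  · intro w hw
    have h1 : DifferentiableAt ℂ (fun w => g (ψ w)) w :=
      (hd _ (hψre w hw)).comp w (hψd w hw)
    exact ((h1.sub_const _).div (h1.add_const _) (hden _ (hψre w hw))).differentiableWithinAt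
  · intro w hw
    have h0 := hre _ (hψre w hw)
    have h1 : 0 < ‖g (ψ w) + G‖ := norm_pos_iff.2 (hden _ (hψre w hw))
    rw [mem_closedBall_zero_iff, norm_div, div_le_one h1]
    rw [← sq_le_sq₀ (norm_nonneg _) (norm_nonneg _), ← Complex.normSq_eq_norm_sq,
      ← Complex.normSq_eq_norm_sq, Complex.normSq_apply, Complex.normSq_apply]
    simp only [Complex.sub_re, Complex.ofReal_re, Complex.add_re, Complex.sub_im,
      Complex.ofReal_im, Complex.add_im]
    nlinarith [mul_nonneg h0 hG.le]
  · simp [hψ, hgx]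
  · rw [Complex.norm_real, Real.norm_eq_abs,
      abs_of_nonneg (div_nonneg (sub_nonneg.2 hxy) (by positivity)), div_lt_one (by positivity)]
    linarith

theorem re_cpow_nonneg {w : ℂ} (hw : w ≠ 0) {p : ℝ} (hp : |p * w.arg| ≤ Real.pi / 2) :
    0 ≤ (w ^ (p : ℂ)).re := by
  rw [Complex.cpow_def_of_ne_zero hw, Complex.exp_re]
  refine mul_nonneg (Real.exp_pos _).le ?_
  rw [Complex.im_mul_ofReal, Complex.log_im, mul_comm]
  have := abs_le.1 hp
  exact Real.cos_nonneg_of_neg_pi_div_two_le_of_le this.1 this.2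

namespace Assumption1

variable {b b' : ℝ → ℝ} {ρ η ω : ℝ}

theorem _root_.laplaceTransform_ofReal (b : ℝ → ℝ) (y : ℝ) :
    laplaceTransform b y = ((∫ t in Ioi 0, Real.exp (-y * t) * b t : ℝ) : ℂ) := by
  unfold laplaceTransform
  rw [← integral_complex_ofReal]
  congr with t
  push_cast
  rfl

theorem integral_exp_mul_pos (hb : Assumption1 b b' ρ) {y : ℝ} (hy : 0 < y) :
    0 < ∫ t in Ioi 0, Real.exp (-y * t) * b t := by
  refine lt_of_le_of_ne' ?_ ?_
  · exact setIntegral_nonneg measurableSet_Ioi fun t ht =>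
      mul_nonneg (Real.exp_pos _).le (hb.nonneg t ht)
  · have := hb.laplaceTransform_ne_zero (z := y) (by simpa using hy)
    rw [laplaceTransform_ofReal] at this
    exact_mod_cast this

theorem rpow_integral_exp_mul_le (hb : Assumption1 b b' ρ) {x y : ℝ} (hx : 0 < x) (hxy : x ≤ y) :
    (∫ t in Ioi 0, Real.exp (-x * t) * b t) ^ (1 / (ρ - 1)) * x ≤
      (∫ t in Ioi 0, Real.exp (-y * t) * b t) ^ (1 / (ρ - 1)) * y := by
  have h1 := hb.rho_mem.1
  have hp : 0 < 1 / (ρ - 1) := by rw [one_div_pos]; linarith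
  have hy : 0 < y := hx.trans_le hxy
  have hx0 := hb.integral_exp_mul_pos hx
  have hy0 := hb.integral_exp_mul_pos hy
  refine mul_le_mul_of_re_nonneg (g := fun z => laplaceTransform b z ^ ((1 / (ρ - 1) : ℝ) : ℂ))
    ?_ ?_ hx hxy (Real.rpow_pos_of_pos hx0 _) (Real.rpow_pos_of_pos hy0 _) ?_ ?_
  · intro z hz
    refine (hb.differentiableAt_laplaceTransform hz).cpow_const (Or.inl ?_)
    exact (mul_pos hb.sectorCos_pos (norm_pos_iff.2 (hb.laplaceTransform_ne_zero hz))).trans_le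
      (hb.re_ge hz)
  · intro z hz
    refine re_cpow_nonneg (hb.laplaceTransform_ne_zero hz) ?_
    rw [abs_mul, abs_of_pos hp]
    calc 1 / (ρ - 1) * |(laplaceTransform b z).arg|
        ≤ 1 / (ρ - 1) * ((ρ - 1) * Real.pi / 2) :=
          mul_le_mul_of_nonneg_left (hb.abs_arg_le hz) hp.le
      _ = Real.pi / 2 := by
          have : ρ - 1 ≠ 0 := by linarith
          field_simp
  · simp only [laplaceTransform_ofReal]
    rw [Complex.ofReal_cpow hx0.le]
  · simp only [laplaceTransform_ofReal]
    rw [Complex.ofReal_cpow hy0.le]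

theorem integral_exp_mul_le_mass (hb : Assumption1 b b' ρ) {r : ℝ} (hr : 0 < r) :
    ∫ t in Ioi 0, Real.exp (-(1 / r) * t) * b t ≤ 2 * ∫ t in Ioc 0 r, b t := by
  have hη : 0 < 1 / r := by positivity
  have hi := hb.integrableOn_exp_mul hη
  have hbr := hb.nonneg r hr
  rw [← Ioc_union_Ioi_eq_Ioi hr.le, setIntegral_union Ioc_disjoint_Ioi_same measurableSet_Ioi
    (hi.mono_set Ioc_subset_Ioi_self) (hi.mono_set (Ioi_subset_Ioi hr.le))]
  have h1 : ∫ t in Ioc 0 r, Real.exp (-(1 / r) * t) * b t ≤ ∫ t in Ioc 0 r, b t := by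
    refine setIntegral_mono_on (hi.mono_set Ioc_subset_Ioi_self) (hb.locInt r hr)
      measurableSet_Ioc fun t ht => ?_
    refine mul_le_of_le_one_left (hb.nonneg t ht.1) (Real.exp_le_one_iff.2 ?_)
    rw [neg_mul, neg_nonpos]
    exact mul_nonneg hη.le ht.1.le
  have h2 : ∫ t in Ioi r, Real.exp (-(1 / r) * t) * b t ≤ r * b r := by
    calc _ ≤ ∫ t in Ioi r, Real.exp (-(1 / r) * t) * b r := by
          refine setIntegral_mono_on (hi.mono_set (Ioi_subset_Ioi hr.le))
            ((integrableOn_exp_mul_Ioi (by linarith) r).mul_const _) measurableSet_Ioi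
            fun t ht => ?_
          exact mul_le_mul_of_nonneg_left (hb.anti hr (hr.trans ht) (le_of_lt ht))
            (Real.exp_pos _).le
      _ = Real.exp (-1) * (r * b r) := by
          rw [integral_mul_const, integral_exp_mul_Ioi (by linarith)]
          have : -(1 / r) * r = -1 := by field_simp
          rw [this]
          field_simp
      _ ≤ _ := mul_le_of_le_one_left (by positivity) (Real.exp_le_one_iff.2 (by norm_num))
  have h3 : r * b r ≤ ∫ t in Ioc 0 r, b t := by
    calc r * b r = ∫ _ in Ioc 0 r, b r := by
          rw [setIntegral_const]
          simp [measureReal_def, ENNReal.toReal_ofReal hr.le]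
      _ ≤ _ := setIntegral_mono_on (by simp) (hb.locInt _ hr) measurableSet_Ioc fun t ht =>
        hb.anti ht.1 hr ht.2
  linarith

/-- The mass of the kernel near the origin decays at most like the power `ρ - 1`. -/
theorem exists_rpow_le_mass (hb : Assumption1 b b' ρ) {T₀ : ℝ} (hT₀ : 0 < T₀) :
    ∃ c > 0, ∀ τ, 0 < τ → τ ≤ T₀ → c * τ ^ (ρ - 1) ≤ ∫ t in Ioc 0 τ, b t := by
  have h1 := hb.rho_mem.1
  have hρ : 0 < ρ - 1 := by linarith
  have hx : 0 < 1 / T₀ := by positivity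
  set X := ∫ t in Ioi 0, Real.exp (-(1 / T₀) * t) * b t with hX
  have hX0 : 0 < X := hb.integral_exp_mul_pos hx
  refine ⟨X * (1 / T₀) ^ (ρ - 1) / 2, by positivity, fun τ hτ hτT => ?_⟩
  have hxy : 1 / T₀ ≤ 1 / τ := one_div_le_one_div_of_le hτ hτT
  have hY0 := hb.integral_exp_mul_pos (y := 1 / τ) (by positivity)
  have h2 := hb.rpow_integral_exp_mul_le hx hxy
  have h3 := hb.integral_exp_mul_le_mass hτ
  set Y := ∫ t in Ioi 0, Real.exp (-(1 / τ) * t) * b t with hY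
  have h4 := Real.rpow_le_rpow (by positivity) h2 hρ.le
  rw [Real.mul_rpow (by positivity) (by positivity), Real.mul_rpow (by positivity) (by positivity),
    ← Real.rpow_mul hX0.le, ← Real.rpow_mul hY0.le, one_div_mul_cancel hρ.ne', Real.rpow_one,
    Real.rpow_one] at h4
  have h5 : (1 / τ) ^ (ρ - 1) * τ ^ (ρ - 1) = 1 := by
    rw [← Real.mul_rpow (by positivity) hτ.le, one_div_mul_cancel hτ.ne', Real.one_rpow]
  have h6 := mul_le_mul_of_nonneg_right h4 (Real.rpow_nonneg hτ.le (ρ - 1))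
  rw [mul_assoc Y, h5, mul_one] at h6
  linarith

end Assumption1

/-- The extension of a real function on the open half line by zero. -/
def halfLine (f : ℝ → ℝ) : ℝ → ℂ := (Ioi 0).indicator fun t => (f t : ℂ)

/-- The convolution on the half line. -/
def halfConv (f g : ℝ → ℝ) (t : ℝ) : ℝ := ∫ u in (0 : ℝ)..t, f u * g (t - u)

section HalfLine

variable {f g : ℝ → ℝ} {ω M : ℝ}

theorem halfLine_apply {t : ℝ} (ht : 0 < t) : halfLine f t = f t :=
  indicator_of_mem (show t ∈ Ioi (0 : ℝ) from ht) _

theorem halfLine_apply_of_le {t : ℝ} (ht : t ≤ 0) : halfLine f t = 0 :=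
  indicator_of_notMem (by simpa using ht) _

theorem integrable_halfLine (hf : IntegrableOn f (Ioi 0)) : Integrable (halfLine f) :=
  (integrable_indicator_iff measurableSet_Ioi).2 hf.ofReal

theorem integrableOn_of_integrable_halfLine (hf : Integrable (halfLine f)) :
    IntegrableOn f (Ioi 0) := by
  have h := ((integrable_indicator_iff measurableSet_Ioi).1 hf).re
  simpa [IntegrableOn] using h

theorem fourier_halfLine (f : ℝ → ℝ) (ξ : ℝ) : 𝓕 (halfLine f) ξ = osc (2 * Real.pi * ξ) f := by
  rw [Real.fourier_real_eq_integral_exp_smul, osc, ← integral_indicator measurableSet_Ioi]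
  congr with t
  by_cases ht : 0 < t
  · rw [halfLine_apply ht, indicator_of_mem (show t ∈ Ioi (0 : ℝ) from ht), smul_eq_mul, mul_comm]
    congr 2
    push_cast
    ring
  · rw [halfLine_apply_of_le (not_lt.1 ht), indicator_of_notMem (by simpa using ht), smul_zero]

theorem osc_eq_fourier (f : ℝ → ℝ) (ω : ℝ) : osc ω f = 𝓕 (halfLine f) (ω / (2 * Real.pi)) := by
  rw [fourier_halfLine, mul_div_cancel₀ _ (by positivity)]

theorem convolution_halfLine (f g : ℝ → ℝ) :
    convolution (halfLine f) (halfLine g) (ContinuousLinearMap.mul ℂ ℂ) volume =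
      halfLine (halfConv f g) := by
  ext t
  rw [convolution_def]
  simp only [ContinuousLinearMap.mul_apply']
  by_cases ht : 0 < t
  · rw [halfLine_apply ht, halfConv, intervalIntegral.integral_of_le ht.le,
      integral_Ioc_eq_integral_Ioo, ← integral_complex_ofReal,
      ← integral_indicator measurableSet_Ioo]
    congr with u
    by_cases hu : u ∈ Ioo 0 t
    · rw [indicator_of_mem hu, halfLine_apply hu.1, halfLine_apply (sub_pos.2 hu.2)]
      push_cast
      rfl
    · rw [indicator_of_notMem hu]
      by_cases h0 : 0 < u
      · rw [halfLine_apply_of_le (f := g), mul_zero]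
        simp only [mem_Ioo, not_and, not_lt] at hu
        linarith [hu h0]
      · rw [halfLine_apply_of_le (not_lt.1 h0), zero_mul]
  · rw [halfLine_apply_of_le (not_lt.1 ht)]
    refine integral_eq_zero_of_ae (.of_forall fun u => ?_)
    by_cases h0 : 0 < u
    · simp only [Pi.zero_apply]
      rw [halfLine_apply_of_le (f := g) (by linarith), mul_zero]
    · simp only [Pi.zero_apply]
      rw [halfLine_apply_of_le (not_lt.1 h0), zero_mul]

theorem integrable_halfConv (hf : IntegrableOn f (Ioi 0)) (hg : IntegrableOn g (Ioi 0)) :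
    IntegrableOn (halfConv f g) (Ioi 0) := by
  refine integrableOn_of_integrable_halfLine ?_
  rw [← convolution_halfLine]
  exact (integrable_halfLine hf).integrable_convolution _ (integrable_halfLine hg)

theorem fourier_halfConv (hf : IntegrableOn f (Ioi 0)) (hg : IntegrableOn g (Ioi 0)) (ξ : ℝ) :
    𝓕 (halfLine (halfConv f g)) ξ = 𝓕 (halfLine f) ξ * 𝓕 (halfLine g) ξ := by
  rw [← convolution_halfLine]
  exact Real.fourier_mul_convolution_eq (integrable_halfLine hf) (integrable_halfLine hg) ξ

theorem osc_halfConv (hf : IntegrableOn f (Ioi 0)) (hg : IntegrableOn g (Ioi 0)) :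
    osc ω (halfConv f g) = osc ω f * osc ω g := by
  rw [osc_eq_fourier, osc_eq_fourier, osc_eq_fourier, fourier_halfConv hf hg]

theorem memLp_halfLine (hf : IntegrableOn f (Ioi 0)) (hM : ∀ t > 0, |f t| ≤ M) :
    MemLp (halfLine f) 2 := by
  have hi := integrable_halfLine hf
  rw [memLp_two_iff_integrable_sq_norm hi.1]
  have : Integrable (fun t => ‖halfLine f t‖ * ‖halfLine f t‖) := by
    refine hi.norm.mul_bdd (c := max M 0) hi.1.norm (.of_forall fun t => ?_)
    rw [norm_norm]
    by_cases ht : 0 < t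
    · rw [halfLine_apply ht, Complex.norm_real]
      exact (hM t ht).trans (le_max_left _ _)
    · rw [halfLine_apply_of_le (not_lt.1 ht), norm_zero]
      exact le_max_right _ _
  simpa only [sq] using this

theorem abs_halfConv_le {t : ℝ} (ht : 0 < t) (hg : IntegrableOn g (Ioc 0 t))
    (hM : ∀ u > 0, |f u| ≤ M) : |halfConv f g t| ≤ M * ∫ u in Ioc 0 t, |g u| := by
  have hgi : IntervalIntegrable (fun u => |g u|) volume 0 t :=
    (intervalIntegrable_iff_integrableOn_Ioc_of_le ht.le).2 hg.abs
  have h1 := hgi.comp_sub_left t (by simp)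
  rw [sub_zero, sub_self] at h1
  have h2 : |halfConv f g t| ≤ ∫ u in (0 : ℝ)..t, M * |g (t - u)| := by
    rw [halfConv, ← Real.norm_eq_abs]
    refine intervalIntegral.norm_integral_le_of_norm_le ht.le (.of_forall fun u hu => ?_)
      (h1.symm.const_mul M)
    rw [norm_mul, Real.norm_eq_abs, Real.norm_eq_abs]
    exact mul_le_mul_of_nonneg_right (hM u hu.1) (abs_nonneg _)
  rwa [intervalIntegral.integral_const_mul,
    intervalIntegral.integral_comp_sub_left (fun u => |g u|) t, sub_zero, sub_self,
    intervalIntegral.integral_of_le ht.le] at h2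

theorem integral_mul_halfConv_nonneg (hf : IntegrableOn f (Ioi 0)) (hg : IntegrableOn g (Ioi 0))
    (hM : ∀ t > 0, |f t| ≤ M) (hre : ∀ ω, 0 ≤ (osc ω g).re) :
    0 ≤ ∫ t in Ioi 0, f t * halfConv f g t := by
  have hM0 : 0 ≤ M := (abs_nonneg _).trans (hM 1 one_pos)
  have hci := integrable_halfConv hf hg
  have hcb : ∀ t > 0, |halfConv f g t| ≤ M * ∫ u in Ioi 0, |g u| := fun t ht =>
    (abs_halfConv_le ht (hg.mono_set Ioc_subset_Ioi_self) hM).trans <| mul_le_mul_of_nonneg_left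
      (setIntegral_mono_set hg.abs (.of_forall fun t => abs_nonneg _)
        (LE.le.eventuallyLE Ioc_subset_Ioi_self)) hM0
  have hf2 := memLp_halfLine hf hM
  have hc2 := memLp_halfLine hci hcb
  have h := integral_conj_fourier_mul_fourier (integrable_halfLine hf) hf2
    (integrable_halfLine hci) hc2
  have h1 : ∫ t, (starRingEnd ℂ) (halfLine f t) * halfLine (halfConv f g) t =
      ((∫ t in Ioi 0, f t * halfConv f g t : ℝ) : ℂ) := by
    rw [← integral_complex_ofReal, ← integral_indicator measurableSet_Ioi]
    congr with t
    by_cases ht : 0 < t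
    · rw [indicator_of_mem (show t ∈ Ioi (0 : ℝ) from ht), halfLine_apply ht, halfLine_apply ht,
        Complex.conj_ofReal]
      push_cast
      rfl
    · rw [indicator_of_notMem (by simpa using ht), halfLine_apply_of_le (not_lt.1 ht), map_zero,
        zero_mul]
  have hint : Integrable fun ξ => (starRingEnd ℂ) (𝓕 (halfLine f) ξ) *
      𝓕 (halfLine (halfConv f g)) ξ :=
    MemLp.integrable_mul (p := 2) (q := 2)
      (memLp_fourier (integrable_halfLine hf) hf2).star
      (memLp_fourier (integrable_halfLine hci) hc2)
  rw [h1] at h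
  have h2 := congrArg Complex.re h
  rw [Complex.ofReal_re] at h2
  rw [← h2]
  have h3 := integral_re hint
  simp only [RCLike.re_to_complex] at h3
  rw [← h3]
  refine integral_nonneg fun ξ => ?_
  simp only [Pi.zero_apply]
  rw [fourier_halfConv hf hg, ← mul_assoc, Complex.conj_mul', ← Complex.ofReal_pow,
    Complex.re_ofReal_mul, fourier_halfLine g]
  exact mul_nonneg (by positivity) (hre _)

end HalfLine

theorem halfConv_exp_mul (f g : ℝ → ℝ) (η t : ℝ) :
    halfConv (fun u => Real.exp (-η * u) * f u) (fun u => Real.exp (-η * u) * g u) t =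
      Real.exp (-η * t) * halfConv f g t := by
  unfold halfConv
  rw [← intervalIntegral.integral_const_mul]
  congr with u
  rw [show -η * t = -η * u + -η * (t - u) by ring, Real.exp_add]
  ring

theorem halfConv_congr {f₁ f₂ g : ℝ → ℝ} {t : ℝ} (ht : 0 < t)
    (h : ∀ u ∈ Ioc 0 t, f₁ u = f₂ u) : halfConv f₁ g t = halfConv f₂ g t := by
  unfold halfConv
  refine intervalIntegral.integral_congr_ae (.of_forall fun u hu => ?_)
  rw [uIoc_of_le ht.le] at hu
  rw [h u hu]

namespace IsScalarSolution

variable {b b' : ℝ → ℝ} {ρ lam : ℝ} {s s' : ℝ → ℝ}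

theorem deriv_eq (hs : IsScalarSolution b lam s s') {t : ℝ} (ht : 0 < t) :
    s' t = -lam * halfConv s b t := by
  have h := hs.eqn t ht
  have h2 : ∫ u in (0 : ℝ)..t, b (t - u) * s u = halfConv s b t := by
    unfold halfConv
    congr with u
    ring
  rw [h2] at h
  linarith

theorem aestronglyMeasurable_deriv (hs : IsScalarSolution b lam s s') :
    AEStronglyMeasurable s' (volume.restrict (Ioi 0)) :=
  (_root_.aestronglyMeasurable_deriv s (volume.restrict (Ioi (0 : ℝ)))).congr
    ((ae_restrict_iff' measurableSet_Ioi).2 (.of_forall fun t ht => (hs.hasDeriv t ht).deriv))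

theorem abs_deriv_le (hb : Assumption1 b b' ρ) (hs : IsScalarSolution b lam s s') (hl : 0 < lam)
    {N M : ℝ} (hM : ∀ t ∈ Icc 0 N, |s t| ≤ M) {t : ℝ} (ht : t ∈ Ioc 0 N) :
    |s' t| ≤ lam * (M * ∫ u in Ioc 0 t, b u) := by
  have hM0 : 0 ≤ M := (abs_nonneg _).trans (hM t ⟨ht.1.le, ht.2⟩)
  rw [hs.deriv_eq ht.1, abs_mul, abs_neg, abs_of_pos hl]
  refine mul_le_mul_of_nonneg_left ?_ hl.le
  rw [halfConv_congr (f₂ := (Icc 0 N).indicator s) ht.1 fun u hu =>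
    (indicator_of_mem (show u ∈ Icc 0 N from ⟨hu.1.le, hu.2.trans ht.2⟩) s).symm]
  refine (abs_halfConv_le ht.1 (hb.locInt t ht.1) (M := M) fun u _ => ?_).trans_eq ?_
  · by_cases hu : u ∈ Icc 0 N
    · rw [indicator_of_mem hu]; exact hM u hu
    · rw [indicator_of_notMem hu, abs_zero]; exact hM0
  · rw [setIntegral_congr_fun measurableSet_Ioc fun u hu => abs_of_nonneg (hb.nonneg u hu.1)]

theorem integrableOn_deriv (hb : Assumption1 b b' ρ) (hs : IsScalarSolution b lam s s')
    (hl : 0 < lam) {N : ℝ} (hN : 0 < N) : IntegrableOn s' (Ioc 0 N) := by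
  obtain ⟨M, hM⟩ := isCompact_Icc.exists_bound_of_continuousOn
    (hs.cont.mono (Icc_subset_Ici_self : Icc 0 N ⊆ Ici 0))
  have hM0 : 0 ≤ M := (norm_nonneg _).trans (hM 0 ⟨le_rfl, hN.le⟩)
  refine Integrable.mono' (integrable_const (lam * (M * ∫ u in Ioc 0 N, b u)))
    (hs.aestronglyMeasurable_deriv.mono_set Ioc_subset_Ioi_self) ?_
  refine (ae_restrict_iff' measurableSet_Ioc).2 (.of_forall fun t ht => ?_)
  refine (hs.abs_deriv_le hb hl (fun t ht => hM t ht) ht).trans ?_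
  refine mul_le_mul_of_nonneg_left (mul_le_mul_of_nonneg_left ?_ hM0) hl.le
  exact setIntegral_mono_set (hb.locInt N hN)
    ((ae_restrict_iff' measurableSet_Ioc).2 (.of_forall fun t ht => hb.nonneg t ht.1))
    (LE.le.eventuallyLE (Ioc_subset_Ioc_right ht.2))

theorem sq_le_exp (hb : Assumption1 b b' ρ) (hs : IsScalarSolution b lam s s') (hl : 0 < lam)
    {N η : ℝ} (hN : 0 < N) (hη : 0 < η) : s N ^ 2 ≤ Real.exp (2 * η * N) := by
  have hcI : ContinuousOn s (Icc 0 N) := hs.cont.mono Icc_subset_Ici_self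
  obtain ⟨M, hM⟩ := isCompact_Icc.exists_bound_of_continuousOn hcI
  have hM0 : 0 ≤ M := (norm_nonneg _).trans (hM 0 ⟨le_rfl, hN.le⟩)
  have hs'i := hs.integrableOn_deriv hb hl hN
  set f : ℝ → ℝ := (Ioc 0 N).indicator fun t => Real.exp (-η * t) * s t with hf
  set g : ℝ → ℝ := fun t => Real.exp (-η * t) * b t with hg
  have hfM : ∀ t > 0, |f t| ≤ M := by
    intro t ht
    by_cases htN : t ∈ Ioc 0 N
    · rw [hf, indicator_of_mem htN, abs_mul, Real.abs_exp]
      exact (mul_le_of_le_one_left (abs_nonneg _)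
        (Real.exp_le_one_iff.2 (by nlinarith))).trans (hM t ⟨ht.le, htN.2⟩)
    · rw [hf, indicator_of_notMem htN, abs_zero]
      exact hM0
  have hfi : IntegrableOn f (Ioi 0) := by
    refine Integrable.integrableOn ?_
    rw [hf, integrable_indicator_iff measurableSet_Ioc]
    exact (ContinuousOn.integrableOn_Icc
      (ContinuousOn.mul (by fun_prop) hcI)).mono_set Ioc_subset_Icc_self
  have hconv : ∀ t ∈ Ioc 0 N, f t * halfConv f g t =
      -(1 / lam) * (Real.exp (-(2 * η) * t) * (s t * s' t)) := by
    intro t ht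
    rw [halfConv_congr (f₂ := fun u => Real.exp (-η * u) * s u) ht.1 fun u hu =>
      indicator_of_mem (show u ∈ Ioc 0 N from ⟨hu.1, hu.2.trans ht.2⟩) _, halfConv_exp_mul,
      hs.deriv_eq ht.1, hf, indicator_of_mem ht,
      show -(2 * η) * t = -η * t + -η * t by ring, Real.exp_add]
    field_simp
  have hpos := integral_mul_halfConv_nonneg hfi (hb.integrableOn_exp_mul hη) hfM (fun ω => by
    rw [← Assumption1.laplaceTransform_eq_osc]
    exact hb.re_nonneg (by simpa using hη))
  have hpos2 : ∫ t in Ioc 0 N, Real.exp (-(2 * η) * t) * (s t * s' t) ≤ 0 := by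
    have h1 : ∫ t in Ioi 0, f t * halfConv f g t = ∫ t in Ioc 0 N, f t * halfConv f g t := by
      refine setIntegral_eq_of_subset_of_forall_sdiff_eq_zero measurableSet_Ioi
        Ioc_subset_Ioi_self fun t ht => ?_
      rw [hf, indicator_of_notMem ht.2, zero_mul]
    change 0 ≤ ∫ t in Ioi 0, f t * halfConv f g t at hpos
    rw [h1, setIntegral_congr_fun measurableSet_Ioc hconv, integral_const_mul] at hpos
    have : 0 < 1 / lam := by positivity
    nlinarith
  have hint1 : IntegrableOn (fun t => Real.exp (-(2 * η) * t) * (s t * s' t)) (Ioc 0 N) := by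
    have h1 : IntegrableOn (fun t => (Real.exp (-(2 * η) * t) * s t) * s' t) (Ioc 0 N) := by
      refine Integrable.bdd_mul (c := M) hs'i
        ((ContinuousOn.mul (by fun_prop) hcI).mono Ioc_subset_Icc_self
          |>.aestronglyMeasurable measurableSet_Ioc) ?_
      refine (ae_restrict_iff' measurableSet_Ioc).2 (.of_forall fun t ht => ?_)
      rw [Real.norm_eq_abs, abs_mul, Real.abs_exp]
      exact (mul_le_of_le_one_left (abs_nonneg _)
        (Real.exp_le_one_iff.2 (by nlinarith [ht.1]))).trans (hM t ⟨ht.1.le, ht.2⟩)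
    simpa only [mul_assoc] using h1
  have hint2 : IntegrableOn (fun t => Real.exp (-(2 * η) * t) * s t ^ 2) (Ioc 0 N) :=
    (ContinuousOn.integrableOn_Icc
      (ContinuousOn.mul (by fun_prop) (hcI.pow 2))).mono_set Ioc_subset_Icc_self
  have hFTC := intervalIntegral.integral_eq_sub_of_hasDerivAt_of_le hN.le
    (f := fun t => Real.exp (-(2 * η) * t) * s t ^ 2)
    (f' := fun t => -(2 * η) * (Real.exp (-(2 * η) * t) * s t ^ 2) +
      2 * (Real.exp (-(2 * η) * t) * (s t * s' t)))
    (ContinuousOn.mul (by fun_prop) (hcI.pow 2)) (fun t ht => by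
      have h1 : HasDerivAt (fun t => Real.exp (-(2 * η) * t))
          (Real.exp (-(2 * η) * t) * (-(2 * η) * 1)) t :=
        ((hasDerivAt_id t).const_mul (-(2 * η))).exp
      refine (h1.mul ((hs.hasDeriv t ht.1).pow 2)).congr_deriv ?_
      push_cast
      simp only [Pi.pow_apply]
      ring)
    ((intervalIntegrable_iff_integrableOn_Ioc_of_le hN.le).2
      (show IntegrableOn (fun t => -(2 * η) * (Real.exp (-(2 * η) * t) * s t ^ 2) +
        2 * (Real.exp (-(2 * η) * t) * (s t * s' t))) (Ioc 0 N) volume from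
        (hint2.const_mul (-(2 * η))).add (hint1.const_mul 2)))
  rw [intervalIntegral.integral_of_le hN.le,
    integral_add (hint2.const_mul _) (hint1.const_mul _), integral_const_mul,
    integral_const_mul, hs.init] at hFTC
  have h0 : 0 ≤ ∫ t in Ioc 0 N, Real.exp (-(2 * η) * t) * s t ^ 2 :=
    setIntegral_nonneg measurableSet_Ioc fun t _ => by positivity
  have h1 : Real.exp (-(2 * η) * N) * s N ^ 2 ≤ 1 := by
    simp only [mul_zero, Real.exp_zero] at hFTC
    nlinarith [mul_nonneg hη.le h0]
  have h2 := mul_le_mul_of_nonneg_left h1 (Real.exp_pos (2 * η * N)).le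
  rwa [← mul_assoc, ← Real.exp_add, neg_mul, add_neg_cancel, Real.exp_zero, one_mul,
    mul_one] at h2

theorem abs_le_one (hb : Assumption1 b b' ρ) (hs : IsScalarSolution b lam s s') (hl : 0 < lam)
    {t : ℝ} (ht : 0 ≤ t) : |s t| ≤ 1 := by
  rcases ht.eq_or_lt with rfl | ht
  · rw [hs.init, abs_one]
  have h1 : Tendsto (fun η : ℝ => Real.exp (2 * η * t)) (nhdsWithin 0 (Ioi 0)) (nhds 1) := by
    have : Continuous fun η : ℝ => Real.exp (2 * η * t) := by fun_prop
    have h2 := (this.tendsto 0).mono_left (nhdsWithin_le_nhds (s := Ioi 0))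
    simpa using h2
  have h2 : s t ^ 2 ≤ 1 := ge_of_tendsto h1 (eventually_mem_nhdsWithin.mono fun η hη =>
    hs.sq_le_exp hb hl ht hη)
  exact (sq_le_one_iff_abs_le_one _).1 h2

theorem abs_deriv_le_mass (hb : Assumption1 b b' ρ) (hs : IsScalarSolution b lam s s')
    (hl : 0 < lam) {t : ℝ} (ht : 0 < t) : |s' t| ≤ lam * ∫ u in Ioc 0 t, b u := by
  have := hs.abs_deriv_le hb hl (N := t) (M := 1)
    (fun u hu => hs.abs_le_one hb hl hu.1) ⟨ht, le_rfl⟩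
  rwa [one_mul] at this

end IsScalarSolution

theorem integrableOn_of_abs_le_exp {f : ℝ → ℝ} {K δ : ℝ}
    (hf : AEStronglyMeasurable f (volume.restrict (Ioi 0))) (hδ : 0 < δ)
    (h : ∀ t > 0, |f t| ≤ K * Real.exp (-δ * t)) : IntegrableOn f (Ioi 0) :=
  Integrable.mono' ((exp_neg_integrableOn_Ioi 0 hδ).const_mul K) hf
    ((ae_restrict_iff' measurableSet_Ioi).2 (.of_forall h))

theorem id_mul_exp_le {δ t : ℝ} (hδ : 0 < δ) :
    t * Real.exp (-(2 * δ) * t) ≤ 1 / δ * Real.exp (-δ * t) := by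
  have h1 : δ * t ≤ Real.exp (δ * t) := by linarith [Real.add_one_le_exp (δ * t)]
  have h2 := mul_le_mul_of_nonneg_right h1 (Real.exp_pos (-(2 * δ) * t)).le
  rw [← Real.exp_add, show δ * t + -(2 * δ) * t = -δ * t by ring] at h2
  rw [div_mul_eq_mul_div, one_mul, le_div_iff₀ hδ]
  linarith

theorem osc_congr {f g : ℝ → ℝ} {ω : ℝ} (h : ∀ t > 0, f t = g t) : osc ω f = osc ω g :=
  setIntegral_congr_fun measurableSet_Ioi fun t ht => by simp only [h t ht]

theorem osc_deriv {f f' : ℝ → ℝ} {ω : ℝ} (hc : ContinuousWithinAt f (Ici 0) 0)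
    (hd : ∀ t > 0, HasDerivAt f (f' t) t) (hf : IntegrableOn f (Ioi 0))
    (hf' : IntegrableOn f' (Ioi 0)) : osc ω f' = ω * Complex.I * osc ω f - f 0 := by
  have h0 : Tendsto f atTop (nhds 0) :=
    tendsto_zero_of_hasDerivAt_of_integrableOn_Ioi (fun t ht => hd t ht) hf' hf
  have hE : ∀ t : ℝ, HasDerivAt (fun t : ℝ => Complex.exp (-(ω * t) * Complex.I))
      (Complex.exp (-(ω * t) * Complex.I) * (-(ω * Complex.I))) t := by
    intro t
    have h1 : HasDerivAt (fun t : ℝ => -((ω : ℂ) * t) * Complex.I) (-(ω * Complex.I)) t := by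
      have := (Complex.ofRealCLM.hasDerivAt (x := t)).const_mul (-((ω : ℂ) * Complex.I))
      refine (this.congr_deriv (by simp)).congr_of_eventuallyEq (.of_forall fun u => ?_)
      simp
      ring
    exact h1.cexp
  have h := integral_Ioi_of_hasDerivAt_of_tendsto (a := 0) (m := (0 : ℂ))
    (f := fun t : ℝ => (f t : ℂ) * Complex.exp (-(ω * t) * Complex.I))
    (f' := fun t : ℝ => (f' t : ℂ) * Complex.exp (-(ω * t) * Complex.I) +
      -(ω * Complex.I) * ((f t : ℂ) * Complex.exp (-(ω * t) * Complex.I)))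
    ((Complex.continuous_ofReal.continuousAt.comp_continuousWithinAt hc).mul
      (hE 0).continuousAt.continuousWithinAt)
    (fun t ht => ((hd t ht).ofReal_comp.mul (hE t)).congr_deriv (by ring))
    ((integrableOn_mul_exp_I hf').add ((integrableOn_mul_exp_I hf).const_mul _)) (by
      refine tendsto_zero_iff_norm_tendsto_zero.2 ?_
      simpa only [norm_mul, norm_exp_neg_mul_I, mul_one, Complex.norm_real, norm_zero] using h0.norm)
  rw [integral_add (integrableOn_mul_exp_I hf') ((integrableOn_mul_exp_I hf).const_mul _),
    integral_const_mul] at h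
  change osc ω f' + -(ω * Complex.I) * osc ω f = _ at h
  simp only [Complex.ofReal_zero, mul_zero, neg_zero, zero_mul, Complex.exp_zero, mul_one] at h
  linear_combination h

theorem id_mul_halfConv {f g : ℝ → ℝ} {t : ℝ} (ht : 0 < t) (hf : ContinuousOn f (Icc 0 t))
    (hg : IntegrableOn g (Ioc 0 t)) :
    t * halfConv f g t = halfConv (fun u => u * f u) g t + halfConv f (fun u => u * g u) t := by
  have hg' : IntervalIntegrable g volume 0 t :=
    (intervalIntegrable_iff_integrableOn_Ioc_of_le ht.le).2 hg
  have hg2 : IntervalIntegrable (fun u => g (t - u)) volume 0 t := by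
    simpa using (hg'.comp_sub_left t).symm
  have hfc : ContinuousOn f (uIcc 0 t) := by rwa [uIcc_of_le ht.le]
  unfold halfConv
  have h1 : IntervalIntegrable (fun u => u * f u * g (t - u)) volume 0 t :=
    hg2.continuousOn_mul (continuousOn_id.mul hfc)
  have h2 : IntervalIntegrable (fun u => f u * ((t - u) * g (t - u))) volume 0 t := by
    have := hg2.continuousOn_mul (g := fun u => f u * (t - u)) (hfc.mul (by fun_prop))
    simpa only [mul_assoc] using this
  rw [← intervalIntegral.integral_add h1 h2, ← intervalIntegral.integral_const_mul]
  congr with u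
  ring

theorem Assumption1.norm_mul_osc_id_mul_le {b b' : ℝ → ℝ} {ρ η : ℝ} (hb : Assumption1 b b' ρ)
    (hη : 0 < η) : ∃ K > 0, ∀ ω : ℝ,
    ‖(η + ω * Complex.I : ℂ)‖ * ‖osc ω (fun t => t * (Real.exp (-η * t) * b t))‖ ≤
      K * ‖osc ω (fun t => Real.exp (-η * t) * b t)‖ := by
  have hK := hb.decreasingKernel hη
  have hti := hb.integrableOn_id_mul_exp_mul hη
  set β : ℝ → ℝ := fun t => Real.exp (-η * t) * b t with hβ
  set I := ∫ t in Ioi 0, t * β t with hI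
  have hI0 : 0 ≤ I := setIntegral_nonneg measurableSet_Ioi fun t ht =>
    mul_nonneg (le_of_lt ht) (hK.nonneg t ht)
  set m := ∫ t in Ioc 0 (1 / η), β t with hm
  have hm0 : 0 < m := by
    have h1 := hb.mass_le_exp_mul hη (r := 1 / η) (by positivity)
    exact pos_of_mul_pos_right ((hb.mass_pos (by positivity)).trans_le h1) (Real.exp_pos _).le
  have hmle : ∀ {r}, 1 / η ≤ r → m ≤ ∫ t in Ioc 0 r, β t := fun {r} hr =>
    setIntegral_mono_set (hK.int.mono_set Ioc_subset_Ioi_self)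
      ((ae_restrict_iff' measurableSet_Ioc).2 (.of_forall fun t ht => hK.nonneg t ht.1))
      (LE.le.eventuallyLE (Ioc_subset_Ioc_right hr))
  refine ⟨400 + 20 * η * I / m, by positivity, fun ω => ?_⟩
  have hz : ‖(η + ω * Complex.I : ℂ)‖ ≤ η + |ω| := by
    refine (norm_add_le _ _).trans_eq ?_
    simp [abs_of_pos hη]
  set N := ‖osc ω β‖ with hN
  set M := ‖osc ω (fun t => t * β t)‖ with hM
  have hN0 : 0 ≤ N := norm_nonneg _
  have hM0 : 0 ≤ M := norm_nonneg _
  have hx : 0 ≤ 20 * η * I / m := by positivity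
  rcases le_or_gt η |ω| with hω | hω
  · have := hK.abs_mul_norm_osc_id_mul_le (ω := ω) (hb.convexOn_exp_mul hη) hti
    change |ω| * M ≤ 200 * N at this
    have := mul_le_mul_of_nonneg_right hz hM0
    nlinarith [mul_nonneg hx hN0]
  · have hMI : M ≤ I := norm_integral_mul_exp_I_le measurableSet_Ioi fun t ht =>
      mul_nonneg (le_of_lt ht) (hK.nonneg t ht)
    have hmN : m ≤ 10 * N := by
      rcases eq_or_ne ω 0 with rfl | hω0
      · have h1 : (osc 0 β).re = ∫ t in Ioi 0, β t := by
          rw [osc_re hK.int]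
          simp
        have h2 : m ≤ ∫ t in Ioi 0, β t := setIntegral_mono_set hK.int
          ((ae_restrict_iff' measurableSet_Ioi).2 (.of_forall fun t ht => hK.nonneg t ht))
          (LE.le.eventuallyLE Ioc_subset_Ioi_self)
        linarith [Complex.re_le_norm (osc 0 β)]
      · exact (hmle (one_div_le_one_div_of_le (abs_pos.2 hω0) hω.le)).trans
          (hK.integral_Ioc_le_norm_osc (hb.convexOn_exp_mul hη) hω0)
    have h3 : ‖(η + ω * Complex.I : ℂ)‖ * M ≤ 2 * η * I :=
      mul_le_mul (by linarith) hMI hM0 (by positivity)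
    have h4 : 20 * η * I / m * N = 2 * η * I * (10 * N / m) := by field_simp; ring
    have h5 : 1 ≤ 10 * N / m := (one_le_div hm0).2 hmN
    have h6 : 2 * η * I ≤ 2 * η * I * (10 * N / m) := le_mul_of_one_le_right (by positivity) h5
    linarith

namespace IsScalarSolution

variable {b b' : ℝ → ℝ} {ρ lam η : ℝ} {s s' : ℝ → ℝ}

theorem abs_deriv_le_exp (hb : Assumption1 b b' ρ) (hs : IsScalarSolution b lam s s')
    (hl : 0 < lam) (hη : 0 < η) : ∃ K, ∀ t > 0, |s' t| ≤ K * Real.exp (η * t) := by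
  refine ⟨lam * ∫ u in Ioi 0, Real.exp (-η * u) * b u, fun t ht => ?_⟩
  have hK := hb.decreasingKernel hη
  have h1 : ∫ u in Ioc 0 t, Real.exp (-η * u) * b u ≤ ∫ u in Ioi 0, Real.exp (-η * u) * b u :=
    setIntegral_mono_set hK.int
      ((ae_restrict_iff' measurableSet_Ioi).2 (.of_forall fun t ht => hK.nonneg t ht))
      (LE.le.eventuallyLE Ioc_subset_Ioi_self)
  refine (hs.abs_deriv_le_mass hb hl ht).trans ?_
  rw [mul_assoc]
  refine mul_le_mul_of_nonneg_left ((hb.mass_le_exp_mul hη ht).trans ?_) hl.le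
  rw [mul_comm]
  exact mul_le_mul_of_nonneg_right h1 (Real.exp_pos _).le

theorem aestronglyMeasurable (hs : IsScalarSolution b lam s s') :
    AEStronglyMeasurable s (volume.restrict (Ioi 0)) :=
  (hs.cont.mono Ioi_subset_Ici_self).aestronglyMeasurable measurableSet_Ioi

theorem integrableOn_exp_mul (hb : Assumption1 b b' ρ) (hs : IsScalarSolution b lam s s')
    (hl : 0 < lam) (hη : 0 < η) : IntegrableOn (fun t => Real.exp (-η * t) * s t) (Ioi 0) := by
  refine integrableOn_of_abs_le_exp (K := 1)
    (Continuous.aestronglyMeasurable (by fun_prop) |>.mul hs.aestronglyMeasurable) hη fun t ht => ?_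
  rw [abs_mul, Real.abs_exp, one_mul]
  exact mul_le_of_le_one_right (Real.exp_pos _).le (hs.abs_le_one hb hl (le_of_lt ht))

theorem integrableOn_id_mul_exp_mul (hb : Assumption1 b b' ρ) (hs : IsScalarSolution b lam s s')
    (hl : 0 < lam) (hη : 0 < η) :
    IntegrableOn (fun t => t * (Real.exp (-η * t) * s t)) (Ioi 0) := by
  refine integrableOn_of_abs_le_exp (K := 1 / (η / 2)) (δ := η / 2)
    (Continuous.aestronglyMeasurable (by fun_prop) |>.mul
      (Continuous.aestronglyMeasurable (by fun_prop) |>.mul hs.aestronglyMeasurable))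
    (by positivity) fun t ht => ?_
  have ht0 : 0 < t := ht
  rw [abs_mul, abs_mul, Real.abs_exp, abs_of_pos ht0]
  refine le_trans ?_ (id_mul_exp_le (half_pos hη))
  rw [mul_div_cancel₀ _ two_ne_zero]
  exact mul_le_mul_of_nonneg_left
    (mul_le_of_le_one_right (Real.exp_pos _).le (hs.abs_le_one hb hl ht0.le)) ht0.le

theorem exp_mul_abs_deriv_le (hb : Assumption1 b b' ρ) (hs : IsScalarSolution b lam s s')
    (hl : 0 < lam) (hη : 0 < η) :
    ∃ K, ∀ t > 0, |Real.exp (-η * t) * s' t| ≤ K * Real.exp (-(η / 2) * t) := by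
  obtain ⟨K, hK⟩ := hs.abs_deriv_le_exp hb hl (half_pos hη)
  refine ⟨K, fun t ht => ?_⟩
  rw [abs_mul, Real.abs_exp]
  refine (mul_le_mul_of_nonneg_left (hK t ht) (Real.exp_pos _).le).trans_eq ?_
  rw [mul_left_comm, ← Real.exp_add]
  ring_nf

theorem integrableOn_exp_mul_deriv (hb : Assumption1 b b' ρ) (hs : IsScalarSolution b lam s s')
    (hl : 0 < lam) (hη : 0 < η) : IntegrableOn (fun t => Real.exp (-η * t) * s' t) (Ioi 0) := by
  obtain ⟨K, hK⟩ := hs.exp_mul_abs_deriv_le hb hl hη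
  exact integrableOn_of_abs_le_exp
    (Continuous.aestronglyMeasurable (by fun_prop) |>.mul hs.aestronglyMeasurable_deriv)
    (half_pos hη) hK

theorem id_mul_exp_mul_abs_deriv_le (hb : Assumption1 b b' ρ) (hs : IsScalarSolution b lam s s')
    (hl : 0 < lam) (hη : 0 < η) :
    ∃ K, ∀ t > 0, |t * (Real.exp (-η * t) * s' t)| ≤ K * Real.exp (-(η / 4) * t) := by
  obtain ⟨K, hK⟩ := hs.exp_mul_abs_deriv_le hb hl hη
  have hK0 : 0 ≤ K := nonneg_of_mul_nonneg_left ((abs_nonneg _).trans (hK 1 one_pos))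
    (Real.exp_pos _)
  refine ⟨K * (1 / (η / 4)), fun t ht => ?_⟩
  have h1 := id_mul_exp_le (t := t) (show 0 < η / 4 by positivity)
  rw [abs_mul, abs_of_pos ht, mul_assoc]
  refine (mul_le_mul_of_nonneg_left (hK t ht) (le_of_lt ht)).trans ?_
  rw [mul_left_comm]
  refine mul_le_mul_of_nonneg_left ?_ hK0
  rwa [show 2 * (η / 4) = η / 2 by ring] at h1

theorem integrableOn_id_mul_exp_mul_deriv (hb : Assumption1 b b' ρ)
    (hs : IsScalarSolution b lam s s') (hl : 0 < lam) (hη : 0 < η) :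
    IntegrableOn (fun t => t * (Real.exp (-η * t) * s' t)) (Ioi 0) := by
  obtain ⟨K, hK⟩ := hs.id_mul_exp_mul_abs_deriv_le hb hl hη
  exact integrableOn_of_abs_le_exp (Continuous.aestronglyMeasurable (by fun_prop) |>.mul
    (Continuous.aestronglyMeasurable (by fun_prop) |>.mul hs.aestronglyMeasurable_deriv))
    (by positivity) hK

theorem hasDerivAt_exp_mul (hs : IsScalarSolution b lam s s') {t : ℝ} (ht : 0 < t) :
    HasDerivAt (fun t => Real.exp (-η * t) * s t)
      (Real.exp (-η * t) * s' t + -η * (Real.exp (-η * t) * s t)) t :=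
  ((((hasDerivAt_id t).const_mul (-η)).exp).mul (hs.hasDeriv t ht)).congr_deriv (by
    simp only [id]
    ring)

theorem continuousOn_exp_mul (hs : IsScalarSolution b lam s s') :
    ContinuousOn (fun t => Real.exp (-η * t) * s t) (Ici 0) :=
  ContinuousOn.mul (by fun_prop) hs.cont

theorem osc_exp_mul_deriv (hb : Assumption1 b b' ρ) (hs : IsScalarSolution b lam s s')
    (hl : 0 < lam) (hη : 0 < η) (ω : ℝ) :
    osc ω (fun t => Real.exp (-η * t) * s' t) =
      (η + ω * Complex.I) * osc ω (fun t => Real.exp (-η * t) * s t) - 1 := by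
  have h1 := hs.integrableOn_exp_mul_deriv hb hl hη
  have h2 := (hs.integrableOn_exp_mul hb hl hη).const_mul (-η)
  have h := osc_deriv (ω := ω) (hs.continuousOn_exp_mul (η := η) 0 self_mem_Ici)
    (fun t ht => hs.hasDerivAt_exp_mul ht) (hs.integrableOn_exp_mul hb hl hη) (h1.add h2)
  rw [osc_add h1 h2, osc_const_mul] at h
  simp only [mul_zero, Real.exp_zero, hs.init, mul_one, Complex.ofReal_one] at h
  push_cast at h
  linear_combination h

theorem osc_id_mul_exp_mul_deriv (hb : Assumption1 b b' ρ) (hs : IsScalarSolution b lam s s')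
    (hl : 0 < lam) (hη : 0 < η) (ω : ℝ) :
    osc ω (fun t => t * (Real.exp (-η * t) * s' t)) =
      (η + ω * Complex.I) * osc ω (fun t => t * (Real.exp (-η * t) * s t)) -
        osc ω (fun t => Real.exp (-η * t) * s t) := by
  have h0 := hs.integrableOn_exp_mul hb hl hη
  have h1 := hs.integrableOn_id_mul_exp_mul_deriv hb hl hη
  have h2 := (hs.integrableOn_id_mul_exp_mul hb hl hη).const_mul (-η)
  have h12 : IntegrableOn (fun t => t * (Real.exp (-η * t) * s' t) +
      -η * (t * (Real.exp (-η * t) * s t))) (Ioi 0) volume := h1.add h2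
  have h := osc_deriv (ω := ω) (f := fun t => t * (Real.exp (-η * t) * s t))
    (f' := fun t => Real.exp (-η * t) * s t + (t * (Real.exp (-η * t) * s' t) +
      -η * (t * (Real.exp (-η * t) * s t))))
    ((continuousOn_id.mul (hs.continuousOn_exp_mul (η := η))) 0 self_mem_Ici)
    (fun t ht => ((hasDerivAt_id t).mul (hs.hasDerivAt_exp_mul (η := η) ht)).congr_deriv (by
      simp only [id]
      ring)) (hs.integrableOn_id_mul_exp_mul hb hl hη) (h0.add h12)
  rw [osc_add h0 h12, osc_add h1 h2, osc_const_mul] at h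
  simp only [zero_mul, Complex.ofReal_zero] at h
  push_cast at h
  linear_combination h

theorem exp_mul_deriv_eq (hs : IsScalarSolution b lam s s') {t : ℝ} (ht : 0 < t) :
    Real.exp (-η * t) * s' t = -lam * halfConv (fun u => Real.exp (-η * u) * s u)
      (fun u => Real.exp (-η * u) * b u) t := by
  rw [halfConv_exp_mul, hs.deriv_eq ht]
  ring

theorem osc_exp_mul_deriv' (hb : Assumption1 b b' ρ) (hs : IsScalarSolution b lam s s')
    (hl : 0 < lam) (hη : 0 < η) (ω : ℝ) :
    osc ω (fun t => Real.exp (-η * t) * s' t) =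
      -lam * (osc ω (fun t => Real.exp (-η * t) * s t) *
        osc ω (fun t => Real.exp (-η * t) * b t)) := by
  rw [osc_congr fun t ht => hs.exp_mul_deriv_eq ht, osc_const_mul,
    osc_halfConv (hs.integrableOn_exp_mul hb hl hη) (hb.integrableOn_exp_mul hη)]
  push_cast
  ring

theorem osc_id_mul_exp_mul_deriv' (hb : Assumption1 b b' ρ) (hs : IsScalarSolution b lam s s')
    (hl : 0 < lam) (hη : 0 < η) (ω : ℝ) :
    osc ω (fun t => t * (Real.exp (-η * t) * s' t)) =
      -lam * (osc ω (fun t => t * (Real.exp (-η * t) * s t)) *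
          osc ω (fun t => Real.exp (-η * t) * b t) +
        osc ω (fun t => Real.exp (-η * t) * s t) *
          osc ω (fun t => t * (Real.exp (-η * t) * b t))) := by
  have i1 := hs.integrableOn_exp_mul hb hl hη
  have i2 := hs.integrableOn_id_mul_exp_mul hb hl hη
  have i3 := hb.integrableOn_exp_mul hη
  have i4 := hb.integrableOn_id_mul_exp_mul hη
  rw [← osc_halfConv i2 i3, ← osc_halfConv i1 i4,
    ← osc_add (integrable_halfConv i2 i3) (integrable_halfConv i1 i4),
    show -(lam : ℂ) = ((-lam : ℝ) : ℂ) by push_cast; ring, ← osc_const_mul]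
  refine osc_congr fun t ht => ?_
  rw [← id_mul_halfConv ht ((hs.continuousOn_exp_mul (η := η)).mono Icc_subset_Ici_self)
    (i3.mono_set Ioc_subset_Ioi_self), hs.exp_mul_deriv_eq ht]
  ring

end IsScalarSolution

theorem integral_inv_one_add_mul_sq {a : ℝ} (ha : 0 < a) :
    Integrable (fun x : ℝ => (1 + (a * x) ^ 2)⁻¹) ∧
      ∫ x : ℝ, (1 + (a * x) ^ 2)⁻¹ = Real.pi / a := by
  refine ⟨(integrable_inv_one_add_sq).comp_mul_left' ha.ne', ?_⟩
  rw [Measure.integral_comp_mul_left (fun x : ℝ => (1 + x ^ 2)⁻¹) a,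
    integral_univ_inv_one_add_sq, abs_of_pos (inv_pos.2 ha), smul_eq_mul, inv_mul_eq_div]

namespace Assumption1

variable {b b' : ℝ → ℝ} {ρ : ℝ}

theorem mass_mono (hb : Assumption1 b b' ρ) {r₁ r₂ : ℝ} (hr₁ : 0 < r₁) (h : r₁ ≤ r₂) :
    ∫ t in Ioc 0 r₁, b t ≤ ∫ t in Ioc 0 r₂, b t :=
  setIntegral_mono_set (hb.locInt r₂ (hr₁.trans_le h))
    ((ae_restrict_iff' measurableSet_Ioc).2 (.of_forall fun t ht => hb.nonneg t ht.1))
    (LE.le.eventuallyLE (Ioc_subset_Ioc_right h))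

theorem exists_mul_mass_eq (hb : Assumption1 b b' ρ) {T₀ y : ℝ} (hT₀ : 0 < T₀) (hy : 0 < y)
    (h : y ≤ T₀ * ∫ t in Ioc 0 T₀, b t) :
    ∃ τ, 0 < τ ∧ τ ≤ T₀ ∧ τ * ∫ t in Ioc 0 τ, b t = y := by
  have hc : ContinuousOn (fun r => r * ∫ t in Ioc 0 r, b t) (Icc 0 T₀) := by
    refine continuousOn_id.mul ?_
    exact intervalIntegral.continuousOn_primitive
      ((integrableOn_Icc_iff_integrableOn_Ioc).2 (hb.locInt T₀ hT₀))
  obtain ⟨τ, hτ, he⟩ := intermediate_value_Icc hT₀.le hc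
    (show y ∈ Icc _ _ from ⟨by simpa using hy.le, h⟩)
  refine ⟨τ, hτ.1.lt_of_ne ?_, hτ.2, he⟩
  rintro rfl
  simp at he
  exact hy.ne he

end Assumption1

namespace IsScalarSolution

variable {b b' : ℝ → ℝ} {ρ lam η : ℝ} {s s' : ℝ → ℝ}

theorem norm_osc_id_mul_exp_mul_deriv_le (hb : Assumption1 b b' ρ) (hη : 0 < η) :
    ∃ K > 0, ∀ {lam : ℝ} {s s' : ℝ → ℝ}, IsScalarSolution b lam s s' → 0 < lam → ∀ ω : ℝ,
      (‖(η + ω * Complex.I : ℂ)‖ + lam * ‖osc ω (fun t => Real.exp (-η * t) * b t)‖) *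
        ‖osc ω (fun t => t * (Real.exp (-η * t) * s' t))‖ ≤ K := by
  obtain ⟨K, hK, hKb⟩ := hb.norm_mul_osc_id_mul_le hη
  have hc := hb.sectorCos_pos
  refine ⟨9 * (1 + K) / sectorCos ρ ^ 2, by positivity, fun {lam s s'} hs hl ω => ?_⟩
  have hD := hb.norm_add_ge (z := η + ω * Complex.I) (l := lam) (by simpa using hη) hl.le
  rw [Assumption1.laplaceTransform_eq_osc] at hD
  have h1 := hs.osc_exp_mul_deriv hb hl hη ω
  have h2 := hs.osc_exp_mul_deriv' hb hl hη ω
  have h3 := hs.osc_id_mul_exp_mul_deriv hb hl hη ω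
  have h4 := hs.osc_id_mul_exp_mul_deriv' hb hl hη ω
  have hKω := hKb ω
  have hz : 0 < ‖(η + ω * Complex.I : ℂ)‖ := by
    rw [norm_pos_iff]
    intro h
    have := congrArg Complex.re h
    simp at this
    exact hη.ne' this
  set z : ℂ := η + ω * Complex.I with hzd
  set β₀ := osc ω (fun t => Real.exp (-η * t) * b t)
  set β₁ := osc ω (fun t => t * (Real.exp (-η * t) * b t))
  set F := osc ω (fun t => Real.exp (-η * t) * s t)
  set G := osc ω (fun t => t * (Real.exp (-η * t) * s t))
  set Q := osc ω (fun t => t * (Real.exp (-η * t) * s' t))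
  set X := ‖z‖ + lam * ‖β₀‖ with hX
  have hX0 : 0 < X := by positivity
  have e1 : F * (z + lam * β₀) = 1 := by linear_combination h2 - h1
  have e2 : Q * (z + lam * β₀) ^ 2 = -lam * (β₀ + z * β₁) := by
    linear_combination (z + lam * β₀) * (lam * β₀ * h3 + z * h4) - lam * (β₀ + z * β₁) * e1
  have e3 : ‖Q‖ * ‖z + lam * β₀‖ ^ 2 ≤ (1 + K) * X := by
    rw [← norm_pow, ← norm_mul, e2, norm_mul, norm_neg, Complex.norm_real, Real.norm_eq_abs,
      abs_of_pos hl]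
    have h5 : ‖β₀ + z * β₁‖ ≤ (1 + K) * ‖β₀‖ := by
      refine (norm_add_le _ _).trans ?_
      rw [norm_mul]
      linarith
    have h6 := mul_le_mul_of_nonneg_left h5 hl.le
    have h7 : lam * ‖β₀‖ ≤ X := by linarith
    nlinarith
  have e4 : (sectorCos ρ * X) ^ 2 ≤ (3 * ‖z + lam * β₀‖) ^ 2 :=
    pow_le_pow_left₀ (by positivity) hD 2
  rw [le_div_iff₀ (by positivity)]
  have e5 := mul_le_mul_of_nonneg_left e4 (norm_nonneg Q)
  refine le_of_mul_le_mul_right ?_ hX0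
  nlinarith

theorem integral_sq_id_mul_deriv_le (hb : Assumption1 b b' ρ) (hη : 0 < η) (T : ℝ) :
    ∃ K > 0, ∀ {lam τ : ℝ} {s s' : ℝ → ℝ}, IsScalarSolution b lam s s' → 0 < lam → 0 < τ →
      η * τ ≤ 1 → 1 ≤ 2 * lam * (τ * ∫ t in Ioc 0 τ, b t) →
      ∫ t in Ioc 0 T, (t * s' t) ^ 2 ≤ K * τ := by
  obtain ⟨K, hK, hKb⟩ := norm_osc_id_mul_exp_mul_deriv_le hb hη
  refine ⟨Real.exp (2 * η * T) * (3601 * K ^ 2), by positivity,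
    fun {lam τ s s'} hs hl hτ hητ hτl => ?_⟩
  have hker := hb.decreasingKernel hη
  set ψ : ℝ → ℝ := fun t => t * (Real.exp (-η * t) * s' t) with hψ
  have hψi : IntegrableOn ψ (Ioi 0) := hs.integrableOn_id_mul_exp_mul_deriv hb hl hη
  have hψ2 : MemLp (halfLine ψ) 2 := by
    obtain ⟨M, hM⟩ := hs.id_mul_exp_mul_abs_deriv_le hb hl hη
    have hM0 : 0 ≤ M := nonneg_of_mul_nonneg_left ((abs_nonneg _).trans (hM 1 one_pos))
      (Real.exp_pos _)
    exact memLp_halfLine hψi (M := M) fun t ht => (hM t ht).trans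
      (mul_le_of_le_one_right hM0 (Real.exp_le_one_iff.2 (by
        have : 0 < t := ht
        nlinarith [mul_pos hη this])))
  have hX : ∀ ω : ℝ, ω ≠ 0 → 1 + (τ * ω) ^ 2 ≤ 3601 *
      (τ * (‖(η + ω * Complex.I : ℂ)‖ + lam * ‖osc ω (fun t => Real.exp (-η * t) * b t)‖)) ^ 2 := by
    intro ω hω
    have h1 : |ω| ≤ ‖(η + ω * Complex.I : ℂ)‖ := by
      simpa using Complex.abs_im_le_norm (η + ω * Complex.I : ℂ)
    set N := ‖osc ω (fun t => Real.exp (-η * t) * b t)‖ with hN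
    have hN0 : 0 ≤ lam * N := mul_nonneg hl.le (norm_nonneg _)
    set X := ‖(η + ω * Complex.I : ℂ)‖ + lam * N with hX
    have h2 : |ω| ≤ X := by linarith
    have h3 : 1 ≤ 60 * (τ * X) := by
      rcases le_or_gt (τ * |ω|) 1 with h | h
      · have h4 : τ ≤ 1 / |ω| := by rwa [le_div_iff₀ (abs_pos.2 hω)]
        have h5 : ∫ t in Ioc 0 τ, Real.exp (-η * t) * b t ≤
            ∫ t in Ioc 0 (1 / |ω|), Real.exp (-η * t) * b t :=
          setIntegral_mono_set (hker.int.mono_set Ioc_subset_Ioi_self)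
            ((ae_restrict_iff' measurableSet_Ioc).2 (.of_forall fun t ht => hker.nonneg t ht.1))
            (LE.le.eventuallyLE (Ioc_subset_Ioc_right h4))
        have h6 := hker.integral_Ioc_le_norm_osc (hb.convexOn_exp_mul hη) hω
        have h7 := hb.mass_le_exp_mul hη hτ
        have h8 : Real.exp (η * τ) ≤ 3 :=
          (Real.exp_le_exp.2 hητ).trans (Real.exp_one_lt_d9.le.trans (by norm_num))
        have h9 : ∫ t in Ioc 0 τ, b t ≤ 30 * N := by
          refine h7.trans ?_
          have h10 : ∫ t in Ioc 0 τ, Real.exp (-η * t) * b t ≤ 10 * N := h5.trans h6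
          have := mul_le_mul h8 h10 (setIntegral_nonneg measurableSet_Ioc fun t ht =>
            hker.nonneg t ht.1) (by norm_num)
          linarith
        have h11 : lam * τ * ∫ t in Ioc 0 τ, b t ≤ lam * τ * (30 * N) :=
          mul_le_mul_of_nonneg_left h9 (by positivity)
        have h12 : τ * (lam * N) ≤ τ * X :=
          mul_le_mul_of_nonneg_left (by linarith [norm_nonneg (η + ω * Complex.I : ℂ)]) hτ.le
        nlinarith
      · have := mul_le_mul_of_nonneg_left h2 hτ.le
        linarith
    have h4 : (τ * ω) ^ 2 ≤ (τ * X) ^ 2 := by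
      rw [← sq_abs, abs_mul, abs_of_pos hτ]
      exact pow_le_pow_left₀ (by positivity) (mul_le_mul_of_nonneg_left h2 hτ.le) 2
    have h5 : 1 ≤ (60 * (τ * X)) ^ 2 := one_le_pow₀ h3
    nlinarith
  have hQ : ∀ ξ : ℝ, ξ ≠ 0 → ‖𝓕 (halfLine ψ) ξ‖ ^ 2 ≤
      3601 * K ^ 2 * τ ^ 2 * (1 + (2 * Real.pi * τ * ξ) ^ 2)⁻¹ := by
    intro ξ hξ
    rw [fourier_halfLine, ← div_eq_mul_inv, le_div_iff₀ (by positivity)]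
    have hω : 2 * Real.pi * ξ ≠ 0 := by positivity
    have h1 := hX _ hω
    have h2 := hKb hs hl (2 * Real.pi * ξ)
    change _ * ‖osc (2 * Real.pi * ξ) ψ‖ ≤ K at h2
    set N := ‖osc (2 * Real.pi * ξ) ψ‖
    set X := ‖((η : ℂ) + (2 * Real.pi * ξ : ℝ) * Complex.I)‖ + lam *
      ‖osc (2 * Real.pi * ξ) (fun t => Real.exp (-η * t) * b t)‖
    have h3 : (X * N) ^ 2 ≤ K ^ 2 := pow_le_pow_left₀ (by positivity) h2 2
    have h4 := mul_le_mul_of_nonneg_left h1 (sq_nonneg N)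
    have h5 := mul_le_mul_of_nonneg_left h3 (sq_nonneg τ)
    rw [show τ * (2 * Real.pi * ξ) = 2 * Real.pi * τ * ξ by ring] at h4
    nlinarith
  have hI := integral_inv_one_add_mul_sq (a := 2 * Real.pi * τ) (by positivity)
  have hW : ∫ ξ, ‖𝓕 (halfLine ψ) ξ‖ ^ 2 ≤ 3601 * K ^ 2 * τ := by
    refine (integral_mono_of_nonneg (.of_forall fun ξ => by positivity)
      (hI.1.const_mul (3601 * K ^ 2 * τ ^ 2)) ?_).trans ?_
    · filter_upwards [Measure.ae_ne volume (0 : ℝ)] with ξ hξ using hQ ξ hξ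
    · rw [integral_const_mul, hI.2]
      have hpi := Real.pi_pos
      rw [show 3601 * K ^ 2 * τ ^ 2 * (Real.pi / (2 * Real.pi * τ)) = 3601 * K ^ 2 * τ / 2 by
        field_simp]
      have : 0 < 3601 * K ^ 2 * τ := by positivity
      linarith
  rw [integral_norm_sq_fourier (integrable_halfLine hψi) hψ2] at hW
  have hH : (fun t => ‖halfLine ψ t‖ ^ 2) = (Ioi 0).indicator fun t => ψ t ^ 2 := by
    ext t
    by_cases ht : 0 < t
    · rw [halfLine_apply ht, indicator_of_mem (show t ∈ Ioi 0 from ht), Complex.norm_real,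
        Real.norm_eq_abs, sq_abs]
    · rw [halfLine_apply_of_le (not_lt.1 ht), indicator_of_notMem (show t ∉ Ioi 0 from ht)]
      simp
  have hi2 : IntegrableOn (fun t => ψ t ^ 2) (Ioi 0) := by
    rw [← integrable_indicator_iff measurableSet_Ioi, ← hH]
    exact hψ2.integrable_norm_pow two_ne_zero
  rw [hH, integral_indicator measurableSet_Ioi] at hW
  have h0 : ∫ t in Ioc 0 T, (t * s' t) ^ 2 ≤ ∫ t in Ioc 0 T, Real.exp (2 * η * T) * ψ t ^ 2 := by
    refine integral_mono_of_nonneg (.of_forall fun t => by positivity)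
      ((hi2.mono_set Ioc_subset_Ioi_self).const_mul _)
      ((ae_restrict_iff' measurableSet_Ioc).2 (.of_forall fun t ht => ?_))
    have h1 : ψ t ^ 2 = Real.exp (-(2 * η * t)) * (t * s' t) ^ 2 := by
      rw [hψ, show -(2 * η * t) = -η * t + -η * t by ring, Real.exp_add]
      ring
    simp only [h1]
    rw [← mul_assoc, ← Real.exp_add]
    refine le_mul_of_one_le_left (by positivity) (Real.one_le_exp ?_)
    nlinarith [mul_nonneg hη.le (sub_nonneg.2 ht.2)]
  refine h0.trans ?_
  rw [integral_const_mul, mul_assoc, mul_assoc]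
  refine mul_le_mul_of_nonneg_left ((setIntegral_mono_set hi2 ?_ ?_).trans
    (hW.trans_eq (by ring))) (Real.exp_pos _).le
  · exact .of_forall fun t => sq_nonneg _
  · exact LE.le.eventuallyLE Ioc_subset_Ioi_self

end IsScalarSolution

namespace IsScalarSolution

variable {b b' : ℝ → ℝ} {ρ lam : ℝ} {s s' : ℝ → ℝ}

theorem integrableOn_mul_deriv (hb : Assumption1 b b' ρ) (hs : IsScalarSolution b lam s s')
    (hl : 0 < lam) {g : ℝ → ℝ} {l r : ℝ} (hl0 : 0 ≤ l) (hg : ContinuousOn g (Icc l r)) :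
    IntegrableOn (fun t => g t * s' t) (Ioc l r) := by
  rcases le_or_gt r l with hlr | hlr
  · simp [Ioc_eq_empty (not_lt.2 hlr)]
  have h1 : IntegrableOn s' (Ioc l r) :=
    (hs.integrableOn_deriv hb hl (hl0.trans_lt hlr)).mono_set (Ioc_subset_Ioc_left hl0)
  exact h1.continuousOn_mul_of_subset hg isCompact_Icc measurableSet_Ioc Ioc_subset_Icc_self

theorem integrableOn_mul_deriv_sq (hb : Assumption1 b b' ρ) (hs : IsScalarSolution b lam s s')
    (hl : 0 < lam) {g : ℝ → ℝ} {l r : ℝ} (hl0 : 0 ≤ l) (hg : ContinuousOn g (Icc l r)) :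
    IntegrableOn (fun t => g t * s' t ^ 2) (Ioc l r) := by
  have h1 := hs.integrableOn_mul_deriv hb hl hl0 hg
  have h2 : IntegrableOn (fun t => s' t * (g t * s' t)) (Ioc l r) := by
    refine Integrable.bdd_mul (c := lam * ∫ u in Ioc 0 r, b u) h1
      (hs.aestronglyMeasurable_deriv.mono_set fun t ht => hl0.trans_lt ht.1)
      ((ae_restrict_iff' measurableSet_Ioc).2 (.of_forall fun t ht => ?_))
    have ht0 : 0 < t := hl0.trans_lt ht.1
    exact (hs.abs_deriv_le_mass hb hl ht0).trans
      (mul_le_mul_of_nonneg_left (hb.mass_mono ht0 ht.2) hl.le)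
  refine h2.congr (.of_forall fun t => ?_)
  ring

theorem integral_sq_sub_le (hb : Assumption1 b b' ρ) (hs : IsScalarSolution b lam s s')
    (hl : 0 < lam) {l r : ℝ} (hl0 : 0 ≤ l) (hlr : l ≤ r) :
    ∫ v in Ioc l r, (s v - s r) ^ 2 ≤ 4 * ∫ v in Ioc l r, (v - l) ^ 2 * s' v ^ 2 := by
  have hsc : ContinuousOn s (Icc l r) := hs.cont.mono fun t ht => hl0.trans ht.1
  have hdc : ContinuousOn (fun v => s v - s r) (Icc l r) := hsc.sub continuousOn_const
  have i1 : IntegrableOn (fun v => (s v - s r) ^ 2) (Ioc l r) :=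
    (ContinuousOn.integrableOn_Icc (hdc.pow 2)).mono_set Ioc_subset_Icc_self
  have i2 : IntegrableOn (fun v => 2 * (v - l) * (s v - s r) * s' v) (Ioc l r) :=
    hs.integrableOn_mul_deriv hb hl hl0 (ContinuousOn.mul (by fun_prop) hdc)
  have i3 : IntegrableOn (fun v => (v - l) ^ 2 * s' v ^ 2) (Ioc l r) :=
    hs.integrableOn_mul_deriv_sq hb hl hl0 (by fun_prop)
  have i12 : IntegrableOn (fun v => (s v - s r) ^ 2 + 2 * (v - l) * (s v - s r) * s' v)
    (Ioc l r) volume := i1.add i2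
  have hFTC := intervalIntegral.integral_eq_sub_of_hasDerivAt_of_le hlr
    (f := fun v => (v - l) * (s v - s r) ^ 2)
    (f' := fun v => (s v - s r) ^ 2 + 2 * (v - l) * (s v - s r) * s' v)
    (ContinuousOn.mul (by fun_prop) (hdc.pow 2)) (fun t ht => by
      have h1 := ((hs.hasDeriv t (hl0.trans_lt ht.1)).sub_const (s r)).pow 2
      refine (((hasDerivAt_id t).sub_const l).mul h1).congr_deriv ?_
      simp only [id, Pi.pow_apply]
      push_cast
      ring)
    ((intervalIntegrable_iff_integrableOn_Ioc_of_le hlr).2 i12)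
  rw [intervalIntegral.integral_of_le hlr] at hFTC
  simp only [sub_self, ne_eq, OfNat.ofNat_ne_zero, not_false_eq_true, zero_pow, mul_zero,
    zero_mul] at hFTC
  have h := setIntegral_mono_on (f := fun v => 1 / 2 * (s v - s r) ^ 2)
    (g := fun v => ((s v - s r) ^ 2 + 2 * (v - l) * (s v - s r) * s' v) +
      2 * ((v - l) ^ 2 * s' v ^ 2)) (i1.const_mul (1 / 2)) (i12.add (i3.const_mul 2))
    measurableSet_Ioc fun v _ => by nlinarith [sq_nonneg ((s v - s r) + 2 * (v - l) * s' v)]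
  rw [integral_add i12 (i3.const_mul 2), integral_const_mul, integral_const_mul, hFTC] at h
  linarith

theorem exists_time_scale (hb : Assumption1 b b' ρ) {lam₀ T : ℝ} (hl₀ : 0 < lam₀) (hT : 0 < T) :
    ∃ C > 0, ∀ {lam : ℝ} {s s' : ℝ → ℝ}, IsScalarSolution b lam s s' → lam₀ ≤ lam →
      ∃ τ > 0, τ ≤ C * lam ^ (-(1 / ρ)) ∧ (∫ t in Ioc 0 T, t ^ 2 * s' t ^ 2 ≤ C * τ) ∧
        ∫ t in Ioc 0 T, t * s' t ^ 2 ≤ C := by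
  have hρ : 1 < ρ := hb.rho_mem.1
  have hρ0 : 0 < ρ := by linarith
  have hB1 : 0 < ∫ t in Ioc 0 1, b t := hb.mass_pos one_pos
  set T₀ : ℝ := max T (max 1 (1 / (2 * lam₀ * ∫ t in Ioc 0 1, b t))) with hT₀d
  have hT₀T : T ≤ T₀ := le_max_left _ _
  have hT₀1 : 1 ≤ T₀ := (le_max_left _ _).trans (le_max_right _ _)
  have hT₀ : 0 < T₀ := by linarith
  have hT₀m : 1 ≤ 2 * lam₀ * (T₀ * ∫ t in Ioc 0 T₀, b t) := by
    have h1 : 1 / (2 * lam₀ * ∫ t in Ioc 0 1, b t) ≤ T₀ :=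
      (le_max_right _ _).trans (le_max_right _ _)
    rw [div_le_iff₀ (by positivity)] at h1
    have h2 := hb.mass_mono one_pos hT₀1
    have h3 : T₀ * (2 * lam₀ * ∫ t in Ioc 0 1, b t) ≤ T₀ * (2 * lam₀ * ∫ t in Ioc 0 T₀, b t) := by
      gcongr
    linarith
  obtain ⟨c, hc, hcb⟩ := hb.exists_rpow_le_mass hT₀
  obtain ⟨K, hK, hKb⟩ := integral_sq_id_mul_deriv_le hb (one_div_pos.2 hT₀) T
  set C₁ : ℝ := (1 / (2 * c)) ^ (1 / ρ) with hC₁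
  have hC₁0 : 0 < C₁ := by positivity
  refine ⟨max C₁ (K + 1), by positivity, fun {lam s s'} hs hll => ?_⟩
  have hl : 0 < lam := hl₀.trans_le hll
  have hBT₀ := hb.mass_pos hT₀
  obtain ⟨τ, hτ, hττ, hτe⟩ := hb.exists_mul_mass_eq hT₀ (y := 1 / (2 * lam)) (by positivity) (by
    rw [div_le_iff₀ (by positivity)]
    refine hT₀m.trans ?_
    rw [mul_comm]
    gcongr)
  have hBτ := hb.mass_pos hτ
  have hW := hKb hs hl hτ (by rw [div_mul_eq_mul_div, one_mul]; exact (div_le_one hT₀).2 hττ)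
    (by rw [hτe]; field_simp; rfl)
  simp only [mul_pow] at hW
  refine ⟨τ, hτ, ?_, hW.trans ?_, ?_⟩
  · have h1 : c * τ ^ ρ ≤ 1 / (2 * lam) := by
      rw [← hτe]
      have h2 := mul_le_mul_of_nonneg_left (hcb τ hτ hττ) hτ.le
      have h3 : τ * (c * τ ^ (ρ - 1)) = c * τ ^ ρ := by
        rw [mul_left_comm, Real.rpow_sub_one hτ.ne', mul_div_cancel₀ _ hτ.ne']
      linarith
    have h4 : τ ^ ρ ≤ 1 / (2 * c) * lam⁻¹ := by
      rw [← le_div_iff₀' hc] at h1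
      refine h1.trans_eq ?_
      field_simp
    have h5 := Real.rpow_le_rpow (by positivity) h4 (one_div_pos.2 hρ0).le
    rw [← Real.rpow_mul hτ.le, mul_one_div_cancel hρ0.ne', Real.rpow_one,
      Real.mul_rpow (by positivity) (by positivity), Real.inv_rpow hl.le, ← Real.rpow_neg hl.le]
      at h5
    exact h5.trans (mul_le_mul_of_nonneg_right (le_max_left _ _) (by positivity))
  · exact mul_le_mul_of_nonneg_right (by linarith [le_max_right C₁ (K + 1)]) hτ.le
  · have i1 : IntegrableOn (fun t => t * s' t ^ 2) (Ioc 0 T) :=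
      hs.integrableOn_mul_deriv_sq hb hl le_rfl continuousOn_id
    have i2 : IntegrableOn (fun t => t ^ 2 * s' t ^ 2) (Ioc 0 T) :=
      hs.integrableOn_mul_deriv_sq hb hl le_rfl (by fun_prop)
    have i3 : IntegrableOn ((Ioc 0 τ).indicator fun _ => 1 / (4 * τ)) (Ioc 0 T) :=
      (integrableOn_const (by simp)).indicator measurableSet_Ioc
    have h := setIntegral_mono_on (g := fun t => (Ioc 0 τ).indicator (fun _ => 1 / (4 * τ)) t +
      1 / τ * (t ^ 2 * s' t ^ 2)) i1 (i3.add (i2.const_mul _)) measurableSet_Ioc fun t ht => by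
        by_cases htτ : t ≤ τ
        · rw [indicator_of_mem (show t ∈ Ioc 0 τ from ⟨ht.1, htτ⟩)]
          have h1 : |s' t| ≤ lam * (1 / (2 * lam * τ)) := by
            refine (hs.abs_deriv_le_mass hb hl ht.1).trans
              (mul_le_mul_of_nonneg_left ((hb.mass_mono ht.1 htτ).trans_eq ?_) hl.le)
            rw [eq_div_iff (by positivity)] at hτe ⊢
            linarith
          have h2 : |s' t| ≤ 1 / (2 * τ) := h1.trans_eq (by field_simp)
          have h3 : s' t ^ 2 ≤ (1 / (2 * τ)) ^ 2 := by
            rw [← sq_abs]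
            exact pow_le_pow_left₀ (abs_nonneg _) h2 2
          have h4 : t * s' t ^ 2 ≤ τ * (1 / (2 * τ)) ^ 2 :=
            mul_le_mul htτ h3 (sq_nonneg _) hτ.le
          have h5 : τ * (1 / (2 * τ)) ^ 2 = 1 / (4 * τ) := by field_simp; norm_num
          have h6 : 0 ≤ 1 / τ * (t ^ 2 * s' t ^ 2) := by positivity
          linarith
        · have h1 : (Ioc 0 τ).indicator (fun _ => 1 / (4 * τ)) t = 0 :=
            indicator_of_notMem (fun h => htτ h.2) _
          rw [h1, zero_add, one_div, inv_mul_eq_div, le_div_iff₀ hτ]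
          have := mul_le_mul_of_nonneg_left (le_of_not_ge htτ)
            (mul_nonneg ht.1.le (sq_nonneg (s' t)))
          nlinarith
    rw [integral_add i3 (i2.const_mul _), integral_const_mul,
      setIntegral_indicator measurableSet_Ioc] at h
    have h1 : ∫ _ in Ioc 0 T ∩ Ioc 0 τ, 1 / (4 * τ) ≤ ∫ _ in Ioc 0 τ, 1 / (4 * τ) :=
      setIntegral_mono_set (integrableOn_const (by simp)) (.of_forall fun _ => by positivity)
        (LE.le.eventuallyLE inter_subset_right)
    have h3 : ∫ _ in Ioc 0 τ, 1 / (4 * τ) = 1 / 4 := by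
      rw [setIntegral_const, measureReal_def, Real.volume_Ioc, sub_zero,
        ENNReal.toReal_ofReal hτ.le, smul_eq_mul]
      field_simp
    have h2 : 1 / τ * ∫ t in Ioc 0 T, t ^ 2 * s' t ^ 2 ≤ K := by
      rw [one_div, inv_mul_eq_div, div_le_iff₀ hτ]
      exact hW
    refine le_trans ?_ (le_max_right C₁ (K + 1))
    linarith

end IsScalarSolution

theorem sum_integral_grid {f : ℝ → ℝ} {T : ℝ} {n : ℕ} (hT : 0 < T) (hn : 1 ≤ n)
    (hf : IntegrableOn f (Ioc 0 T)) :
    ∑ k ∈ Finset.Icc 1 n, ∫ v in Ioc (T - k * (T / n)) (T - ((k : ℝ) - 1) * (T / n)), f v =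
      ∫ v in Ioc 0 T, f v := by
  have hn0 : (0 : ℝ) < n := by exact_mod_cast hn
  set h := T / n with hh
  have hh0 : 0 < h := by positivity
  have hnh : n * h = T := by rw [hh]; field_simp
  have hle : ∀ k : ℕ, T - (k + 1 : ℕ) * h ≤ T - k * h := fun k => by
    push_cast
    linarith
  have h1 := intervalIntegral.sum_integral_adjacent_intervals (f := f) (μ := volume) (n := n)
    (a := fun k => T - k * h) fun k hk => by
      refine (intervalIntegrable_iff_integrableOn_Ioc_of_le (hle k)).2 (hf.mono_set ?_) |>.symm
      have : ((k + 1 : ℕ) : ℝ) * h ≤ n * h :=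
        mul_le_mul_of_nonneg_right (by exact_mod_cast hk) hh0.le
      exact Ioc_subset_Ioc (by linarith) (by linarith [mul_nonneg k.cast_nonneg hh0.le])
  rw [← Finset.Ico_add_one_right_eq_Icc, Finset.sum_Ico_eq_sum_range]
  have h2 : ∀ k : ℕ, ∫ v in Ioc (T - ((1 + k : ℕ) : ℝ) * h) (T - (((1 + k : ℕ) : ℝ) - 1) * h), f v =
      -∫ v in (T - k * h)..(T - (k + 1 : ℕ) * h), f v := fun k => by
    rw [intervalIntegral.integral_symm, neg_neg, intervalIntegral.integral_of_le (hle k)]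
    push_cast
    ring_nf
  simp only [h2, Finset.sum_neg_distrib, Nat.add_sub_cancel]
  rw [h1, intervalIntegral.integral_symm, neg_neg, hnh, sub_self, Nat.cast_zero, zero_mul,
    sub_zero, intervalIntegral.integral_of_le hT.le]

namespace IsScalarSolution

variable {b b' : ℝ → ℝ} {ρ lam : ℝ} {s s' : ℝ → ℝ}

theorem exists_sum_integral_sq_sub_le (hb : Assumption1 b b' ρ) {lam₀ T σ γ : ℝ} (hl₀ : 0 < lam₀)
    (hT : 0 < T) (hσ0 : 0 < σ) (hσ1 : σ ≤ 1 / ρ) (hγ : γ < ρ * σ / 2) :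
    ∃ C > 0, ∀ {lam : ℝ} {s s' : ℝ → ℝ}, IsScalarSolution b lam s s' → lam₀ ≤ lam →
      ∀ n : ℕ, 1 ≤ n →
        ∑ k ∈ Finset.Icc 1 n, ∫ v in Ioc (T - k * (T / n)) (T - ((k : ℝ) - 1) * (T / n)),
          (s v - s (T - ((k : ℝ) - 1) * (T / n))) ^ 2 ≤
        C * (T / n) ^ (2 * γ) * lam ^ (σ - 1 / ρ) := by
  have hρ : 1 < ρ := hb.rho_mem.1
  have hρ0 : 0 < ρ := by linarith
  obtain ⟨C, hC, hCb⟩ := exists_time_scale hb hl₀ hT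
  have hρσ : ρ * σ ≤ 1 := by
    have := mul_le_mul_of_nonneg_left hσ1 hρ0.le
    rwa [mul_one_div_cancel hρ0.ne'] at this
  refine ⟨4 * C * C ^ (1 - ρ * σ) * T ^ (ρ * σ - 2 * γ), by positivity,
    fun {lam s s'} hs hll n hn => ?_⟩
  have hl : 0 < lam := hl₀.trans_le hll
  have hn0 : (0 : ℝ) < n := by exact_mod_cast hn
  obtain ⟨τ, hτ, hτC, hW2, hW1⟩ := hCb hs hll
  have i1 : IntegrableOn (fun t => t * s' t ^ 2) (Ioc 0 T) :=
    hs.integrableOn_mul_deriv_sq hb hl le_rfl continuousOn_id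
  have i2 : IntegrableOn (fun t => t ^ 2 * s' t ^ 2) (Ioc 0 T) :=
    hs.integrableOn_mul_deriv_sq hb hl le_rfl (by fun_prop)
  set h := T / n with hh
  have hh0 : 0 < h := by positivity
  have hhT : h ≤ T := div_le_self hT.le (by exact_mod_cast hn)
  have hnh : n * h = T := by rw [hh]; field_simp
  set S := ∑ k ∈ Finset.Icc 1 n, ∫ v in Ioc (T - k * h) (T - ((k : ℝ) - 1) * h),
    (s v - s (T - ((k : ℝ) - 1) * h)) ^ 2 with hS
  have hgrid : ∀ f : ℝ → ℝ, IntegrableOn f (Ioc 0 T) →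
      (∀ k ∈ Finset.Icc 1 n, ∀ v ∈ Ioc (T - k * h) (T - ((k : ℝ) - 1) * h),
        (v - (T - k * h)) ^ 2 * s' v ^ 2 ≤ f v) → S ≤ 4 * ∫ v in Ioc 0 T, f v := by
    intro f hf hle
    rw [← sum_integral_grid hT hn hf, Finset.mul_sum]
    refine Finset.sum_le_sum fun k hk => ?_
    have hk1 : (1 : ℝ) ≤ k := by exact_mod_cast (Finset.mem_Icc.1 hk).1
    have hkn : (k : ℝ) * h ≤ n * h :=
      mul_le_mul_of_nonneg_right (by exact_mod_cast (Finset.mem_Icc.1 hk).2) hh0.le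
    have hk0 : 0 ≤ ((k : ℝ) - 1) * h := mul_nonneg (by linarith) hh0.le
    refine (hs.integral_sq_sub_le hb hl (by linarith) (by linarith)).trans ?_
    refine mul_le_mul_of_nonneg_left (setIntegral_mono_on
      (hs.integrableOn_mul_deriv_sq hb hl (by linarith) (by fun_prop))
      (hf.mono_set (Ioc_subset_Ioc (by linarith) (by linarith))) measurableSet_Ioc
      (hle k hk)) (by norm_num)
  have hbd : ∀ k ∈ Finset.Icc 1 n, ∀ v ∈ Ioc (T - k * h) (T - ((k : ℝ) - 1) * h),
      0 ≤ v - (T - k * h) ∧ v - (T - k * h) ≤ v ∧ v - (T - k * h) ≤ h := by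
    intro k hk v hv
    have hkn : (k : ℝ) * h ≤ n * h :=
      mul_le_mul_of_nonneg_right (by exact_mod_cast (Finset.mem_Icc.1 hk).2) hh0.le
    refine ⟨by linarith [hv.1], by linarith, by linarith [hv.2]⟩
  have hSτ : S ≤ 4 * C * τ := by
    have := hgrid _ i2 fun k hk v hv => by
      obtain ⟨h1, h2, -⟩ := hbd k hk v hv
      gcongr
    linarith
  have hSh : S ≤ 4 * C * h := by
    have := hgrid _ (i1.const_mul h) fun k hk v hv => by
      obtain ⟨h1, h2, h3⟩ := hbd k hk v hv
      rw [← mul_assoc]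
      refine mul_le_mul_of_nonneg_right ?_ (sq_nonneg _)
      rw [sq]
      exact mul_le_mul h3 h2 h1 hh0.le
    rw [integral_const_mul] at this
    have h4 := mul_le_mul_of_nonneg_left hW1 hh0.le
    linarith
  have hm : min τ h ≤ τ ^ (1 - ρ * σ) * h ^ (ρ * σ) := by
    have hm0 : 0 < min τ h := lt_min hτ hh0
    calc min τ h = min τ h ^ (1 - ρ * σ) * min τ h ^ (ρ * σ) := by
          rw [← Real.rpow_add hm0, sub_add_cancel, Real.rpow_one]
      _ ≤ τ ^ (1 - ρ * σ) * h ^ (ρ * σ) := mul_le_mul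
          (Real.rpow_le_rpow hm0.le (min_le_left _ _) (by linarith))
          (Real.rpow_le_rpow hm0.le (min_le_right _ _) (by positivity)) (by positivity)
          (by positivity)
  have hSm : S ≤ 4 * C * min τ h := by
    rcases min_choice τ h with e | e <;> rw [e] <;> assumption
  have hτp : τ ^ (1 - ρ * σ) ≤ C ^ (1 - ρ * σ) * lam ^ (σ - 1 / ρ) := by
    refine (Real.rpow_le_rpow hτ.le hτC (by linarith)).trans_eq ?_
    rw [Real.mul_rpow hC.le (by positivity), ← Real.rpow_mul hl.le]
    congr 2
    field_simp
    ring
  have hhp : h ^ (ρ * σ) ≤ h ^ (2 * γ) * T ^ (ρ * σ - 2 * γ) := by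
    calc h ^ (ρ * σ) = h ^ (2 * γ) * h ^ (ρ * σ - 2 * γ) := by
          rw [← Real.rpow_add hh0, add_sub_cancel]
      _ ≤ _ := mul_le_mul_of_nonneg_left
          (Real.rpow_le_rpow hh0.le hhT (by linarith)) (by positivity)
  calc S ≤ 4 * C * min τ h := hSm
    _ ≤ 4 * C * (τ ^ (1 - ρ * σ) * h ^ (ρ * σ)) := by gcongr
    _ ≤ 4 * C * ((C ^ (1 - ρ * σ) * lam ^ (σ - 1 / ρ)) *
        (h ^ (2 * γ) * T ^ (ρ * σ - 2 * γ))) := by gcongr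
    _ = _ := by ring

theorem exists_sum_lintegral_sq_sub_le (hb : Assumption1 b b' ρ) {lam₀ T σ γ : ℝ} (hl₀ : 0 < lam₀)
    (hT : 0 < T) (hσ0 : 0 < σ) (hσ1 : σ ≤ 1 / ρ) (hγ : γ < ρ * σ / 2) :
    ∃ C > 0, ∀ {lam : ℝ} {s s' : ℝ → ℝ}, IsScalarSolution b lam s s' → lam₀ ≤ lam →
      ∀ n : ℕ, 1 ≤ n →
        ∑ k ∈ Finset.Icc 1 n,
          ∫⁻ u in Ioc (((k : ℝ) - 1) * (T / (n : ℝ))) ((k : ℝ) * (T / (n : ℝ))),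
            ENNReal.ofReal ((s (T - u) - s (T - ((k : ℝ) - 1) * (T / n))) ^ 2) ≤
        ENNReal.ofReal (C * (T / n) ^ (2 * γ) * lam ^ (σ - 1 / ρ)) := by
  obtain ⟨C, hC, hCb⟩ := exists_sum_integral_sq_sub_le hb hl₀ hT hσ0 hσ1 hγ
  refine ⟨C, hC, fun {lam s s'} hs hll n hn => ?_⟩
  refine le_trans (le_of_eq ?_) (ENNReal.ofReal_le_ofReal (hCb hs hll n hn))
  have hn0 : (0 : ℝ) < n := by exact_mod_cast hn
  rw [ENNReal.ofReal_sum_of_nonneg fun k _ =>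
    setIntegral_nonneg measurableSet_Ioc fun v _ => sq_nonneg _]
  refine Finset.sum_congr rfl fun k hk => ?_
  set h := T / n with hh
  have hh0 : 0 < h := by positivity
  have hnh : n * h = T := by rw [hh]; field_simp
  have hkn : (k : ℝ) * h ≤ n * h :=
    mul_le_mul_of_nonneg_right (by exact_mod_cast (Finset.mem_Icc.1 hk).2) hh0.le
  have hle : ((k : ℝ) - 1) * h ≤ k * h := by linarith
  have hc : ContinuousOn (fun u => (s (T - u) - s (T - ((k : ℝ) - 1) * h)) ^ 2)
      (Icc (((k : ℝ) - 1) * h) (k * h)) := by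
    refine ContinuousOn.pow (ContinuousOn.sub (hs.cont.comp (by fun_prop) fun u hu => ?_)
      continuousOn_const) 2
    show 0 ≤ T - u
    linarith [hu.2]
  rw [← ofReal_integral_eq_lintegral_ofReal (hc.integrableOn_Icc.mono_set Ioc_subset_Icc_self)
    (.of_forall fun u => sq_nonneg _)]
  rw [← intervalIntegral.integral_of_le hle, ← intervalIntegral.integral_of_le (by linarith),
    intervalIntegral.integral_comp_sub_left (fun v => (s v - s (T - ((k : ℝ) - 1) * h)) ^ 2)]

end IsScalarSolution

theorem norm_sq_Sop_sub {H : Type*} [NormedAddCommGroup H] [InnerProductSpace ℝ H]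
    (e : HilbertBasis ℕ ℝ H) {s : ℕ → ℝ → ℝ} {t r : ℝ} (ht : ∀ k, |s k t| ≤ 1)
    (hr : ∀ k, |s k r| ≤ 1) (x : H) :
    ENNReal.ofReal (‖Sop e s t x - Sop e s r x‖ ^ 2) =
      ∑' k, ENNReal.ofReal ((s k t - s k r) ^ 2) * ENNReal.ofReal (⟪x, e k⟫ ^ 2) := by
  have hmem : ∀ {a : ℕ → ℝ}, (∀ k, |a k| ≤ 1) → Memℓp (fun k => a k * ⟪x, e k⟫) 2 := by
    intro a ha
    refine (e.repr x).2.mono' fun k => ?_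
    rw [e.repr_apply_apply, real_inner_comm, norm_mul]
    exact mul_le_of_le_one_left (norm_nonneg _) (ha k)
  have hS : ∀ {v : ℝ} (hv : ∀ k, |s k v| ≤ 1),
      Sop e s v x = e.repr.symm (⟨_, hmem hv⟩ : lp (fun _ : ℕ => ℝ) 2) := fun hv =>
    (e.hasSum_repr_symm ⟨_, hmem hv⟩).tsum_eq
  have hcoef : ∀ k, ⟪(e k : H), Sop e s t x - Sop e s r x⟫ = (s k t - s k r) * ⟪x, e k⟫ := by
    intro k
    rw [hS ht, hS hr, ← map_sub, ← e.repr_apply_apply, LinearIsometryEquiv.apply_symm_apply,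
      lp.coeFn_sub, Pi.sub_apply]
    ring
  have hsum := e.hasSum_inner_mul_inner (Sop e s t x - Sop e s r x) (Sop e s t x - Sop e s r x)
  have hsq : ∀ k, ⟪Sop e s t x - Sop e s r x, e k⟫ * ⟪(e k : H), Sop e s t x - Sop e s r x⟫ =
      (s k t - s k r) ^ 2 * ⟪x, e k⟫ ^ 2 := by
    intro k
    rw [real_inner_comm, hcoef]
    ring
  simp only [hsq, real_inner_self_eq_norm_sq] at hsum
  rw [← hsum.tsum_eq, ENNReal.ofReal_tsum_of_nonneg (fun k => by positivity) hsum.summable]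
  exact tsum_congr fun k => ENNReal.ofReal_mul (sq_nonneg _)

/-- the Hölder type estimate on the resolvent family:
`(Σ_{k=1}^n ∫_{t_{k-1}}^{t_k} ‖(S(t_n-u) - S(t_n-t_{k-1}))x‖² du)^{1/2} ≤ C Δt^γ ‖x‖_{σ-1/ρ}`
for `0 < σ ≤ 1/ρ`, `γ < ρσ/2`, `Δt = T/n`, `t_n = T` (stated in squared form). -/
theorem statement16 {H : Type*} [NormedAddCommGroup H] [InnerProductSpace ℝ H]
    [CompleteSpace H]
    (b b' : ℝ → ℝ) (ρ : ℝ) (hb : Assumption1 b b' ρ)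
    (e : HilbertBasis ℕ ℝ H) (lam : ℕ → ℝ)
    (hlam_pos : ∀ k, 0 < lam k) (hlam_mono : Monotone lam)
    (hlam_top : Tendsto lam atTop atTop)
    (s s' : ℕ → ℝ → ℝ) (hs : ∀ k, IsScalarSolution b (lam k) (s k) (s' k))
    (T σ γ : ℝ) (hT : 0 < T) (hσ0 : 0 < σ) (hσ1 : σ ≤ 1 / ρ) (hγ : γ < ρ * σ / 2) :
    ∃ C > 0, ∀ n : ℕ, 1 ≤ n → ∀ x : H,
      (∑ k ∈ Finset.Icc 1 n,
          ∫⁻ u in Set.Ioc (((k : ℝ) - 1) * (T / (n : ℝ))) ((k : ℝ) * (T / (n : ℝ))),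
            ENNReal.ofReal
              (‖Sop e s (T - u) x - Sop e s (T - ((k : ℝ) - 1) * (T / (n : ℝ))) x‖ ^ 2)) ≤
        ENNReal.ofReal (C ^ 2 * (T / (n : ℝ)) ^ (2 * γ)) *
          ∑' j, ENNReal.ofReal (lam j ^ (σ - 1 / ρ) * ⟪x, e j⟫ ^ 2) := by
  have hl₀ : ∀ j, lam 0 ≤ lam j := fun j => hlam_mono (Nat.zero_le j)
  obtain ⟨C, hC, hCb⟩ := IsScalarSolution.exists_sum_lintegral_sq_sub_le hb (hlam_pos 0) hT
    hσ0 hσ1 hγ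
  refine ⟨√C, Real.sqrt_pos.2 hC, fun n hn x => ?_⟩
  rw [Real.sq_sqrt hC.le]
  have hn0 : (0 : ℝ) < n := by exact_mod_cast hn
  set h := T / (n : ℝ) with hh
  have hh0 : 0 < h := by positivity
  have hnh : n * h = T := by rw [hh]; field_simp
  have hterm : ∀ k ∈ Finset.Icc 1 n,
      ∫⁻ u in Set.Ioc (((k : ℝ) - 1) * h) ((k : ℝ) * h), ENNReal.ofReal
        (‖Sop e s (T - u) x - Sop e s (T - ((k : ℝ) - 1) * h) x‖ ^ 2) =
      ∑' j, (∫⁻ u in Set.Ioc (((k : ℝ) - 1) * h) ((k : ℝ) * h), ENNReal.ofReal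
        ((s j (T - u) - s j (T - ((k : ℝ) - 1) * h)) ^ 2)) * ENNReal.ofReal (⟪x, e j⟫ ^ 2) := by
    intro k hk
    have hkn : (k : ℝ) * h ≤ n * h :=
      mul_le_mul_of_nonneg_right (by exact_mod_cast (Finset.mem_Icc.1 hk).2) hh0.le
    have hmeas : ∀ j, AEMeasurable (fun u => ENNReal.ofReal
        ((s j (T - u) - s j (T - ((k : ℝ) - 1) * h)) ^ 2))
        (volume.restrict (Ioc (((k : ℝ) - 1) * h) ((k : ℝ) * h))) := by
      intro j
      have hc : ContinuousOn (fun u => (s j (T - u) - s j (T - ((k : ℝ) - 1) * h)) ^ 2)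
          (Ioc (((k : ℝ) - 1) * h) (k * h)) := by
        refine ContinuousOn.pow (ContinuousOn.sub ((hs j).cont.comp (by fun_prop) fun u hu => ?_)
          continuousOn_const) 2
        show 0 ≤ T - u
        linarith [hu.2]
      exact (hc.aemeasurable measurableSet_Ioc).ennreal_ofReal
    rw [setLIntegral_congr_fun measurableSet_Ioc fun u hu => norm_sq_Sop_sub e
      (fun j => (hs j).abs_le_one hb (hlam_pos j) (by linarith [hu.2]))
      (fun j => (hs j).abs_le_one hb (hlam_pos j) (by linarith)) x,
      lintegral_tsum fun j => (hmeas j).mul_const _]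
    exact tsum_congr fun j => lintegral_mul_const'' _ (hmeas j)
  rw [Finset.sum_congr rfl hterm, ← Summable.tsum_finsetSum fun _ _ => ENNReal.summable,
    ← ENNReal.tsum_mul_left]
  refine ENNReal.tsum_le_tsum fun j => ?_
  rw [← Finset.sum_mul]
  refine (mul_le_mul_left (hCb (hs j) (hl₀ j) n hn) _).trans_eq ?_
  have hlj := hlam_pos j
  rw [← ENNReal.ofReal_mul (by positivity), ← ENNReal.ofReal_mul (by positivity)]
  congr 1
  ring
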